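/- Let U⁺, U⁻ and U⁰ be the subalgebras of U_q generated respectively by {E_i : i ∈ Î}, by {F_i : i ∈ Î}, and by {K_i, K_i^{−1} (i ∈ Î), γ^{1/2}, γ^{−1/2}}. Then the K-linear map U⁻ ⊗_K U⁰ ⊗_K U⁺ → U_q induced by multiplication, x ⊗ y ⊗ z ↦ xyz, is a bijection (triangular decomposition U_q ≅ U⁻ ⊗ U⁰ ⊗ U⁺). -/

import Mathlib

open scoped BigOperators TensorProduct

noncomputable section

/-- The base field `K = ℚ(q)` of rational functions over `ℚ`. -/
abbrev Kq : Type := RatFunc ℚ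

/-- The element `q ∈ ℚ(q)`. -/
def qvar : Kq := RatFunc.X

/-- Generators of the quantum affine algebra: `E_i`, `F_i`, `K_i`, `K_i⁻¹`, `γ^{1/2}`,
`γ^{-1/2}`. -/
inductive Gen (n : ℕ) : Type
  | E : Fin n → Gen n
  | F : Fin n → Gen n
  | K : Fin n → Gen n
  | Kinv : Fin n → Gen n
  | g : Gen n
  | ginv : Gen n

variable {n : ℕ}

/-- The free algebra on the generators. -/
abbrev FA (n : ℕ) : Type := FreeAlgebra Kq (Gen n)

/-- Inclusion of the generators into the free algebra. -/
def ι : Gen n → FA n := FreeAlgebra.ι Kq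

/-- `q_i = q^{d_i}`. -/
def qi (d : Fin n → ℕ) (i : Fin n) : Kq := qvar ^ (d i)

/-- The quantum integer `[m]_i = (q_i^m - q_i^{-m})/(q_i - q_i⁻¹)`. -/
def qint (d : Fin n → ℕ) (i : Fin n) (m : ℤ) : Kq :=
  (qi d i ^ m - qi d i ^ (-m)) / (qi d i - (qi d i)⁻¹)

/-- The quantum factorial `[m]_i!`. -/
def qfact (d : Fin n → ℕ) (i : Fin n) : ℕ → Kq
  | 0 => 1
  | m + 1 => qfact d i m * qint d i (m + 1)

/-- The quantum binomial coefficient `[m choose s]_i`. -/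
def qbinom (d : Fin n → ℕ) (i : Fin n) (m s : ℕ) : Kq :=
  qfact d i m / (qfact d i s * qfact d i (m - s))

/-- The quantum Serre element `∑_{s=0}^{1-a_{ij}} (-1)^s [1-a_{ij} choose s]_i
E_i^{1-a_{ij}-s} E_j E_i^s` in the free algebra. -/
def serreE (a : Fin n → Fin n → ℤ) (d : Fin n → ℕ) (i j : Fin n) : FA n :=
  ∑ s ∈ Finset.range ((1 - a i j).toNat + 1),
    ((-1 : Kq) ^ s * qbinom d i (1 - a i j).toNat s) •
      (ι (Gen.E i) ^ ((1 - a i j).toNat - s) * ι (Gen.E j) * ι (Gen.E i) ^ s)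

/-- The quantum Serre element in the `F`'s. -/
def serreF (a : Fin n → Fin n → ℤ) (d : Fin n → ℕ) (i j : Fin n) : FA n :=
  ∑ s ∈ Finset.range ((1 - a i j).toNat + 1),
    ((-1 : Kq) ^ s * qbinom d i (1 - a i j).toNat s) •
      (ι (Gen.F i) ^ ((1 - a i j).toNat - s) * ι (Gen.F j) * ι (Gen.F i) ^ s)

/-- The defining relations of the quantum affine algebra `U_q`. -/
inductive QRel (a : Fin n → Fin n → ℤ) (d r : Fin n → ℕ) : FA n → FA n → Prop
  | KKinv (i : Fin n) : QRel a d r (ι (Gen.K i) * ι (Gen.Kinv i)) 1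
  | KinvK (i : Fin n) : QRel a d r (ι (Gen.Kinv i) * ι (Gen.K i)) 1
  | gginv : QRel a d r (ι Gen.g * ι Gen.ginv) 1
  | ginvg : QRel a d r (ι Gen.ginv * ι Gen.g) 1
  | gcomm (x : Gen n) : QRel a d r (ι Gen.g * ι x) (ι x * ι Gen.g)
  | gsq : QRel a d r (ι Gen.g * ι Gen.g)
      (((List.finRange n).map fun i => ι (Gen.K i) ^ r i).prod)
  | KK (i j : Fin n) : QRel a d r (ι (Gen.K i) * ι (Gen.K j)) (ι (Gen.K j) * ι (Gen.K i))
  | KE (i j : Fin n) : QRel a d r (ι (Gen.K i) * ι (Gen.E j))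
      ((qi d i ^ (a i j)) • (ι (Gen.E j) * ι (Gen.K i)))
  | KF (i j : Fin n) : QRel a d r (ι (Gen.K i) * ι (Gen.F j))
      ((qi d i ^ (-(a i j))) • (ι (Gen.F j) * ι (Gen.K i)))
  | EF (i j : Fin n) : QRel a d r (ι (Gen.E i) * ι (Gen.F j) - ι (Gen.F j) * ι (Gen.E i))
      (if i = j then ((qi d i - (qi d i)⁻¹)⁻¹) • (ι (Gen.K i) - ι (Gen.Kinv i)) else 0)
  | serreEE (i j : Fin n) (h : i ≠ j) : QRel a d r (serreE a d i j) 0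
  | serreFF (i j : Fin n) (h : i ≠ j) : QRel a d r (serreF a d i j) 0

/-- The quantum affine algebra `U_q`, presented by the generators and relations above. -/
abbrev Uq (a : Fin n → Fin n → ℤ) (d r : Fin n → ℕ) : Type := RingQuot (QRel a d r)

/-- The images of the generators in `U_q`. -/
def gen (a : Fin n → Fin n → ℤ) (d r : Fin n → ℕ) (x : Gen n) : Uq a d r :=
  RingQuot.mkAlgHom Kq (QRel a d r) (ι x)

/-- The hypotheses on the Cartan data: `A = (a_{ij})` is a symmetrizable generalized Cartan
matrix with symmetrizing positive integers `d_i`, and the positive integers `r_i` satisfy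
`∑_i r_i d_i a_{ij} = 0` for all `j`. -/
structure CartanData (n : ℕ) (a : Fin n → Fin n → ℤ) (d r : Fin n → ℕ) : Prop where
  diag : ∀ i, a i i = 2
  offdiag : ∀ i j, i ≠ j → a i j ≤ 0
  zero_iff : ∀ i j, a i j = 0 ↔ a j i = 0
  symmetrizable : ∀ i j, (d i : ℤ) * a i j = (d j : ℤ) * a j i
  d_pos : ∀ i, 0 < d i
  r_pos : ∀ i, 0 < r i
  null : ∀ j, ∑ i, (r i : ℤ) * (d i : ℤ) * a i j = 0

/-! ### Skew-commuting elements -/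

/-- `x` and `y` commute up to the scalar `c`: `x * y = c • (y * x)`. -/
def SkewComm {k R : Type*} [Field k] [Ring R] [Algebra k R] (c : k) (x y : R) : Prop :=
  x * y = c • (y * x)

namespace SkewComm

variable {k R : Type*} [Field k] [Ring R] [Algebra k R] {c c' : k} {x x' y y' : R}

theorem one_left (y : R) : SkewComm (1 : k) 1 y := by simp [SkewComm]

theorem one_right (x : R) : SkewComm (1 : k) x 1 := by simp [SkewComm]

theorem mul_left (h : SkewComm c x y) (h' : SkewComm c' x' y) :
    SkewComm (c * c') (x * x') y := by
  unfold SkewComm at *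
  rw [mul_assoc, h', mul_smul_comm, ← mul_assoc, h, smul_mul_assoc, smul_smul, mul_assoc,
    mul_comm c]

theorem mul_right (h : SkewComm c x y) (h' : SkewComm c' x y') :
    SkewComm (c * c') x (y * y') := by
  unfold SkewComm at *
  rw [← mul_assoc, h, smul_mul_assoc, mul_assoc, h', mul_smul_comm, smul_smul, mul_assoc]

theorem pow_left (h : SkewComm c x y) (p : ℕ) : SkewComm (c ^ p) (x ^ p) y := by
  induction p with
  | zero => simpa using one_left y
  | succ p ih => simpa [pow_succ] using ih.mul_left h

theorem pow_right (h : SkewComm c x y) (p : ℕ) : SkewComm (c ^ p) x (y ^ p) := by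
  induction p with
  | zero => simpa using one_right x
  | succ p ih => simpa [pow_succ] using ih.mul_right h

theorem of_inverse_left (hc : c ≠ 0) (h : SkewComm c x y) (h₁ : x * x' = 1) (h₂ : x' * x = 1) :
    SkewComm c⁻¹ x' y := by
  unfold SkewComm at *
  have : y * x' = x' * (x * y) * x' := by rw [← mul_assoc x', h₂, one_mul]
  rw [this, h, mul_smul_comm, smul_mul_assoc, smul_smul, inv_mul_cancel₀ hc, one_smul, mul_assoc,
    mul_assoc, h₁, mul_one]

end SkewComm

/-! ### Quantum integers and binomial coefficients -/

theorem qvar_ne_zero : qvar ≠ 0 := RatFunc.X_ne_zero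

theorem qvar_zpow_ne_one {m : ℤ} (hm : m ≠ 0) : qvar ^ m ≠ 1 := by
  intro h
  have key : ∀ p : ℕ, 0 < p → qvar ^ p ≠ 1 := by
    intro p hp h
    have h' : algebraMap (Polynomial ℚ) Kq (Polynomial.X ^ p) = algebraMap (Polynomial ℚ) Kq 1 := by
      simpa [qvar] using h
    have := congrArg Polynomial.natDegree (RatFunc.algebraMap_injective ℚ h')
    simp at this
    omega
  rcases Int.natAbs_eq m with h' | h' <;> rw [h'] at h
  · exact key m.natAbs (by omega) (by exact_mod_cast h)
  · rw [zpow_neg, inv_eq_one] at h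
    exact key m.natAbs (by omega) (by exact_mod_cast h)

/-- The quantum integer `[m]` at the parameter `Q`. -/
def quantumInt {k : Type*} [Field k] (Q : k) (m : ℤ) : k := (Q ^ m - Q ^ (-m)) / (Q - Q⁻¹)

section QuantumInt

variable {k : Type*} [Field k] {Q : k}

theorem quantumInt_zero : quantumInt Q 0 = 0 := by simp [quantumInt]

theorem quantumInt_inv (m : ℤ) : quantumInt Q⁻¹ m = quantumInt Q m := by
  unfold quantumInt
  rw [← neg_div_neg_eq]
  simp

theorem quantumInt_telescope (hQ : Q ≠ 0) (m l : ℤ) :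
    quantumInt Q m * Q ^ l - Q ^ m * quantumInt Q l = quantumInt Q (m - l) := by
  unfold quantumInt
  rw [div_mul_eq_mul_div, mul_div_assoc', ← sub_div]
  congr 1
  rw [neg_sub, sub_mul, mul_sub, ← zpow_add₀ hQ, ← zpow_add₀ hQ, ← zpow_add₀ hQ]
  ring_nf

/-- The alternating sum of quantum binomial coefficients, weighted by `Q ^ (s * (1 - m))`,
vanishes. The coefficients enter only through the recursion they satisfy. -/
theorem sum_quantum_binomial_eq_zero (hQ : Q ≠ 0) {m : ℕ} (hm : quantumInt Q m ≠ 0) {c : ℕ → k}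
    (hc : ∀ s < m, c s * quantumInt Q (m - s) = c (s + 1) * quantumInt Q (s + 1)) :
    ∑ s ∈ Finset.range (m + 1), (-1) ^ s * c s * Q ^ ((s : ℤ) * (1 - m)) = 0 := by
  have partial_sum : ∀ l ≤ m,
      quantumInt Q m * ∑ s ∈ Finset.range (l + 1), (-1) ^ s * c s * Q ^ ((s : ℤ) * (1 - m)) =
        (-1) ^ l * Q ^ (-(l * m : ℤ)) * (c l * quantumInt Q (m - l)) := by
    intro l
    induction l with
    | zero => intro _; simp [mul_comm]
    | succ l ih =>
      intro hl
      rw [Finset.sum_range_succ, mul_add, ih (by omega), hc l (by omega)]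
      push_cast
      rw [← quantumInt_telescope hQ m (l + 1)]
      have e₁ : Q ^ (-(l * m : ℤ)) = Q ^ (-((l + 1) * m : ℤ)) * Q ^ (m : ℤ) := by
        rw [← zpow_add₀ hQ]; ring_nf
      have e₂ : Q ^ (((l : ℤ) + 1) * (1 - m)) = Q ^ (-((l + 1) * m : ℤ)) * Q ^ ((l : ℤ) + 1) := by
        rw [← zpow_add₀ hQ]; ring_nf
      rw [e₁, e₂]
      ring
  have := partial_sum m le_rfl
  rw [sub_self, quantumInt_zero, mul_zero, mul_zero] at this
  exact (mul_eq_zero.mp this).resolve_left hm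

end QuantumInt

theorem qi_ne_zero (d : Fin n → ℕ) (i : Fin n) : qi d i ≠ 0 := pow_ne_zero _ qvar_ne_zero

theorem qi_zpow (d : Fin n → ℕ) (i : Fin n) (m : ℤ) : qi d i ^ m = qvar ^ (d i * m : ℤ) := by
  rw [qi, ← zpow_natCast, ← zpow_mul]

theorem qint_ne_zero {d : Fin n → ℕ} {i : Fin n} (hd : 0 < d i) {m : ℤ} (hm : m ≠ 0) :
    quantumInt (qi d i) m ≠ 0 := by
  have key : ∀ l : ℤ, l ≠ 0 → qi d i ^ l - qi d i ^ (-l) ≠ 0 := by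
    intro l hl h
    refine qvar_zpow_ne_one (m := d i * l + d i * l) ?_ ?_
    · have : (d i : ℤ) * l ≠ 0 := mul_ne_zero (by exact_mod_cast hd.ne') hl
      omega
    · rw [sub_eq_zero, zpow_neg, qi_zpow] at h
      rw [zpow_add₀ qvar_ne_zero]
      nth_rewrite 1 [h]
      exact inv_mul_cancel₀ (zpow_ne_zero _ qvar_ne_zero)
  exact div_ne_zero (key m hm) (by simpa using key 1 one_ne_zero)

theorem qfact_ne_zero {d : Fin n → ℕ} {i : Fin n} (hd : 0 < d i) (m : ℕ) : qfact d i m ≠ 0 := by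
  induction m with
  | zero => exact one_ne_zero
  | succ m ih => exact mul_ne_zero ih (qint_ne_zero hd (by positivity))

theorem qbinom_mul_qint {d : Fin n → ℕ} {i : Fin n} (hd : 0 < d i) {m s : ℕ} (hs : s < m) :
    qbinom d i m s * quantumInt (qi d i) (m - s) =
      qbinom d i m (s + 1) * quantumInt (qi d i) (s + 1) := by
  obtain ⟨t, rfl⟩ : ∃ t, m = s + 1 + t := ⟨m - (s + 1), by omega⟩
  have h₁ : s + 1 + t - s = t + 1 := by omega
  have h₂ : s + 1 + t - (s + 1) = t := by omega
  have h₃ : ((s + 1 + t : ℕ) : ℤ) - s = t + 1 := by push_cast; ring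
  have f : ∀ l : ℕ, qfact d i (l + 1) = qfact d i l * quantumInt (qi d i) (l + 1) := fun l => rfl
  have := qfact_ne_zero hd s
  have := qfact_ne_zero hd t
  have : quantumInt (qi d i) (s + 1) ≠ 0 := qint_ne_zero hd (by positivity)
  have : quantumInt (qi d i) (t + 1) ≠ 0 := qint_ne_zero hd (by positivity)
  rw [h₃, qbinom, qbinom, h₁, h₂, f t, f s]
  field_simp

/-! ### Serre elements and their commutators -/

/-- The quantum Serre element in the family `X` of elements of an arbitrary algebra. -/
def serreElt {R : Type*} [Ring R] [Algebra Kq R] (a : Fin n → Fin n → ℤ) (d : Fin n → ℕ)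
    (X : Fin n → R) (i j : Fin n) : R :=
  ∑ s ∈ Finset.range ((1 - a i j).toNat + 1),
    ((-1 : Kq) ^ s * qbinom d i (1 - a i j).toNat s) •
      (X i ^ ((1 - a i j).toNat - s) * X j * X i ^ s)

theorem map_serreElt {R S : Type*} [Ring R] [Algebra Kq R] [Ring S] [Algebra Kq S]
    (f : R →ₐ[Kq] S) (a : Fin n → Fin n → ℤ) (d : Fin n → ℕ) (X : Fin n → R) (i j : Fin n) :
    f (serreElt a d X i j) = serreElt a d (fun i => f (X i)) i j := by
  simp [serreElt]

/-- The relations of `U_q` among `E`, `F`, `K` and `L = K⁻¹`, except the Serre relations. -/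
structure EFKRel {R : Type*} [Ring R] [Algebra Kq R] (a : Fin n → Fin n → ℤ) (d : Fin n → ℕ)
    (E F K L : Fin n → R) : Prop where
  KL : ∀ i, K i * L i = 1
  LK : ∀ i, L i * K i = 1
  KE : ∀ i j, SkewComm (qi d i ^ a i j) (K i) (E j)
  KF : ∀ i j, SkewComm (qi d i ^ (-a i j)) (K i) (F j)
  EF : ∀ i j, E i * F j - F j * E i =
    if i = j then ((qi d i - (qi d i)⁻¹)⁻¹) • (K i - L i) else 0

section Commutator

variable {k R : Type*} [Field k] [Ring R] [Algebra k R] {Q : k} {E E' F K L : R}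

theorem pow_mul_eq_add_quantumInt (hQ : Q ≠ 0) (hQ' : Q - Q⁻¹ ≠ 0)
    (hK : SkewComm (Q ^ (2 : ℤ)) K E) (hL : SkewComm (Q ^ (-2 : ℤ)) L E)
    (hF : E * F - F * E = (Q - Q⁻¹)⁻¹ • (K - L)) (p : ℕ) :
    E ^ p * F = F * E ^ p + ((Q - Q⁻¹)⁻¹ * quantumInt Q p) •
      (E ^ (p - 1) * (Q ^ (p - 1 : ℤ) • K - Q ^ (1 - p : ℤ) • L)) := by
  induction p with
  | zero => simp [quantumInt]
  | succ p ih =>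
    have hK' : K * E ^ p = Q ^ (2 * p : ℤ) • (E ^ p * K) := by
      have := hK.pow_right p
      rwa [SkewComm, ← zpow_natCast, ← zpow_mul] at this
    have hL' : L * E ^ p = Q ^ (-2 * p : ℤ) • (E ^ p * L) := by
      have := hL.pow_right p
      rwa [SkewComm, ← zpow_natCast, ← zpow_mul] at this
    have hE : E * F = F * E + (Q - Q⁻¹)⁻¹ • (K - L) := by rw [← hF]; abel
    have hE' : ((Q - Q⁻¹)⁻¹ * quantumInt Q p) •
        (E * (E ^ (p - 1) * (Q ^ (p - 1 : ℤ) • K - Q ^ (1 - p : ℤ) • L))) =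
        ((Q - Q⁻¹)⁻¹ * quantumInt Q p) •
        (E ^ p * (Q ^ (p - 1 : ℤ) • K - Q ^ (1 - p : ℤ) • L)) := by
      rcases p with _ | p
      · simp [quantumInt]
      · rw [← mul_assoc, ← pow_succ', Nat.add_sub_cancel]
    rw [pow_succ', mul_assoc, ih, mul_add, mul_smul_comm, hE', ← mul_assoc, hE, add_mul,
      mul_assoc, add_assoc, Nat.add_sub_cancel]
    congr 1
    rw [smul_mul_assoc, sub_mul, hK', hL']
    simp only [mul_sub, mul_smul_comm, quantumInt]
    have e₁ : Q ^ (2 * p : ℤ) = Q ^ (p : ℤ) * Q ^ (p : ℤ) := by rw [← zpow_add₀ hQ]; ring_nf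
    have e₂ : Q ^ (-2 * p : ℤ) = (Q ^ (p : ℤ))⁻¹ * (Q ^ (p : ℤ))⁻¹ := by
      rw [← zpow_neg, ← zpow_add₀ hQ]; ring_nf
    have hz := zpow_ne_zero (p : ℤ) hQ
    have hQ'' : Q ^ 2 - 1 ≠ 0 := fun h => hQ' (by field_simp; simpa using h)
    push_cast
    rw [e₁, e₂]
    simp only [add_sub_cancel_right, sub_eq_add_neg (1 : ℤ), neg_add_rev, ← add_assoc,
      add_neg_cancel, zero_add, zpow_add₀ hQ, zpow_neg, zpow_one,
      sub_eq_add_neg (p : ℤ)]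
    generalize Q ^ (p : ℤ) = z at hz
    match_scalars <;> field_simp <;> ring

/-- The commutator of a monomial `E ^ (m - s) * E' * E ^ s` with `F`, where `F` is dual to `E` and
commutes with `E'`. -/
theorem serreMonomial_comm_of_dual (hQ : Q ≠ 0) (hQ' : Q - Q⁻¹ ≠ 0)
    (hK : SkewComm (Q ^ (2 : ℤ)) K E) (hL : SkewComm (Q ^ (-2 : ℤ)) L E)
    (hF : E * F - F * E = (Q - Q⁻¹)⁻¹ • (K - L)) (hF' : E' * F = F * E') {m : ℕ}
    (hK' : SkewComm (Q ^ (1 - m : ℤ)) K E') (hL' : SkewComm (Q ^ (m - 1 : ℤ)) L E')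
    {s : ℕ} (hs : s ≤ m) :
    E ^ (m - s) * E' * E ^ s * F - F * (E ^ (m - s) * E' * E ^ s) =
      ((Q - Q⁻¹)⁻¹ * quantumInt Q (m - s)) •
        (E ^ (m - 1 - s) * E' * E ^ s * (Q ^ (s : ℤ) • K - Q ^ (-s : ℤ) • L)) +
      ((Q - Q⁻¹)⁻¹ * quantumInt Q s) •
        (E ^ (m - s) * E' * E ^ (s - 1) * (Q ^ (s - 1 : ℤ) • K - Q ^ (1 - s : ℤ) • L)) := by
  have hK₂ : K * (E' * E ^ s) = Q ^ (1 - m + 2 * s : ℤ) • (E' * E ^ s * K) := by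
    have := hK'.mul_right (hK.pow_right s)
    rwa [SkewComm, ← zpow_natCast, ← zpow_mul, ← zpow_add₀ hQ] at this
  have hL₂ : L * (E' * E ^ s) = Q ^ (m - 1 - 2 * s : ℤ) • (E' * E ^ s * L) := by
    have := hL'.mul_right (hL.pow_right s)
    rwa [SkewComm, ← zpow_natCast, ← zpow_mul, ← zpow_add₀ hQ, neg_mul, ← sub_eq_add_neg] at this
  have h₁ := pow_mul_eq_add_quantumInt hQ hQ' hK hL hF s
  have h₂ := pow_mul_eq_add_quantumInt hQ hQ' hK hL hF (m - s)
  have h₃ : E ^ (m - s) * E' * E ^ s * F = E ^ (m - s) * F * (E' * E ^ s) +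
      ((Q - Q⁻¹)⁻¹ * quantumInt Q s) •
        (E ^ (m - s) * E' * E ^ (s - 1) * (Q ^ (s - 1 : ℤ) • K - Q ^ (1 - s : ℤ) • L)) := by
    rw [mul_assoc, h₁, mul_add, mul_smul_comm]
    congr 1
    · rw [← mul_assoc, mul_assoc _ E' F, hF']
      simp only [mul_assoc]
    · simp only [mul_assoc]
  have h₄ : (Q ^ (((m - s : ℕ) : ℤ) - 1) • K - Q ^ (1 - ((m - s : ℕ) : ℤ)) • L) * (E' * E ^ s) =
      E' * E ^ s * (Q ^ (s : ℤ) • K - Q ^ (-s : ℤ) • L) := by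
    rw [sub_mul, smul_mul_assoc, smul_mul_assoc, hK₂, hL₂, smul_smul, smul_smul, ← zpow_add₀ hQ,
      ← zpow_add₀ hQ, mul_sub, mul_smul_comm, mul_smul_comm, Nat.cast_sub hs]
    congr 3 <;> ring_nf
  rw [h₃, h₂, add_mul, smul_mul_assoc, mul_assoc (E ^ (m - s - 1)), h₄, Nat.cast_sub hs,
    Nat.sub_right_comm m s 1]
  simp only [mul_assoc]
  abel

/-- The commutator of a monomial `E ^ (m - s) * E' * E ^ s` with `F`, where `F` is dual to `E'` and
commutes with `E`. -/
theorem serreMonomial_comm_of_dual' {c : k} {e : ℤ}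
    (hK : SkewComm (Q ^ e) K E) (hL : SkewComm (Q ^ (-e)) L E)
    (hF : E' * F - F * E' = c • (K - L)) (hF' : E * F = F * E) {m s : ℕ} (hs : s ≤ m) :
    E ^ (m - s) * E' * E ^ s * F - F * (E ^ (m - s) * E' * E ^ s) =
      (c * Q ^ (s * e : ℤ)) • (E ^ m * K) - (c * Q⁻¹ ^ (s * e : ℤ)) • (E ^ m * L) := by
  have hp : ∀ p, E ^ p * F = F * E ^ p := fun p => Commute.pow_left hF' p
  have hK₂ : K * E ^ s = Q ^ (s * e : ℤ) • (E ^ s * K) := by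
    have := hK.pow_right s
    rwa [SkewComm, ← zpow_natCast, ← zpow_mul, mul_comm] at this
  have hL₂ : L * E ^ s = Q⁻¹ ^ (s * e : ℤ) • (E ^ s * L) := by
    have := hL.pow_right s
    rwa [SkewComm, ← zpow_natCast, ← zpow_mul, mul_comm, mul_neg, zpow_neg, ← inv_zpow] at this
  have h₁ : E ^ (m - s) * E' * E ^ s * F - F * (E ^ (m - s) * E' * E ^ s) =
      E ^ (m - s) * (E' * F - F * E') * E ^ s := by
    rw [mul_assoc _ (E ^ s), hp]
    simp only [mul_sub, sub_mul, ← mul_assoc, hp]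
  rw [h₁, hF, mul_smul_comm, smul_mul_assoc, mul_sub, sub_mul, mul_assoc, mul_assoc, hK₂, hL₂,
    mul_smul_comm, mul_smul_comm, ← mul_assoc, ← mul_assoc, ← pow_add, Nat.sub_add_cancel hs,
    smul_sub, smul_smul, smul_smul]

end Commutator

theorem qi_sub_inv_ne_zero {d : Fin n → ℕ} {i : Fin n} (hd : 0 < d i) :
    qi d i - (qi d i)⁻¹ ≠ 0 := by
  have := qint_ne_zero hd (m := 1) one_ne_zero
  intro h
  simp [quantumInt, h] at this

theorem CartanData.qi_zpow_symm {a : Fin n → Fin n → ℤ} {d r : Fin n → ℕ}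
    (hC : CartanData n a d r) (i j : Fin n) : qi d j ^ a j i = qi d i ^ a i j := by
  rw [qi_zpow, qi_zpow, hC.symmetrizable]

namespace EFKRel

variable {R : Type*} [Ring R] [Algebra Kq R] {a : Fin n → Fin n → ℤ} {d r : Fin n → ℕ}
  {E F K L : Fin n → R}

theorem LE (h : EFKRel a d E F K L) (i j : Fin n) :
    SkewComm (qi d i ^ (-a i j)) (L i) (E j) := by
  rw [zpow_neg]
  exact (h.KE i j).of_inverse_left (zpow_ne_zero _ (qi_ne_zero d i)) (h.KL i) (h.LK i)

theorem LF (h : EFKRel a d E F K L) (i j : Fin n) : SkewComm (qi d i ^ a i j) (L i) (F j) := by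
  have := (h.KF i j).of_inverse_left (zpow_ne_zero _ (qi_ne_zero d i)) (h.KL i) (h.LK i)
  rwa [← zpow_neg, neg_neg] at this

theorem swap (h : EFKRel a d E F K L) : EFKRel a d F E L K where
  KL := h.LK
  LK := h.KL
  KE := h.LF
  KF := h.LE
  EF i j := by
    rw [← neg_sub, h.EF]
    rcases eq_or_ne i j with rfl | hij
    · simp [← smul_neg]
    · simp [hij, hij.symm]

theorem EF_comm (h : EFKRel a d E F K L) {i j : Fin n} (hij : i ≠ j) : E i * F j = F j * E i := by
  simpa [hij, sub_eq_zero] using h.EF i j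

theorem EF_self (h : EFKRel a d E F K L) (i : Fin n) :
    E i * F i - F i * E i = (qi d i - (qi d i)⁻¹)⁻¹ • (K i - L i) := by
  simpa using h.EF i i

/-- The Serre elements in the `E`'s commute with the `F`'s. -/
theorem serreElt_comm (h : EFKRel a d E F K L) (hC : CartanData n a d r) {i j : Fin n}
    (hij : i ≠ j) (l : Fin n) : serreElt a d E i j * F l = F l * serreElt a d E i j := by
  have hQ := qi_ne_zero d i
  have hQ' := qi_sub_inv_ne_zero (hC.d_pos i)
  obtain ⟨m, hm⟩ : ∃ m : ℕ, 1 - a i j = m := ⟨_, (Int.toNat_of_nonneg (by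
    have := hC.offdiag i j hij; omega)).symm⟩
  have hm1 : m ≠ 0 := by have := hC.offdiag i j hij; omega
  have ha : a i j = 1 - m := by omega
  have hrec : ∀ s < m, qbinom d i m s * quantumInt (qi d i) (m - s) =
      qbinom d i m (s + 1) * quantumInt (qi d i) (s + 1) := fun s hs =>
    qbinom_mul_qint (hC.d_pos i) hs
  rw [← sub_eq_zero, serreElt, hm, Int.toNat_natCast, Finset.sum_mul, Finset.mul_sum,
    ← Finset.sum_sub_distrib]
  simp only [smul_mul_assoc, mul_smul_comm, ← smul_sub]
  by_cases hl : l = i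
  · subst l
    have hK' : SkewComm (qi d i ^ (1 - m : ℤ)) (K i) (E j) := ha ▸ h.KE i j
    have hL' : SkewComm (qi d i ^ (m - 1 : ℤ)) (L i) (E j) := by
      simpa [ha] using h.LE i j
    have hKi : SkewComm (qi d i ^ (2 : ℤ)) (K i) (E i) := hC.diag i ▸ h.KE i i
    have hLi : SkewComm (qi d i ^ (-2 : ℤ)) (L i) (E i) := by simpa [hC.diag i] using h.LE i i
    rw [Finset.sum_congr rfl fun s hs => by
      rw [serreMonomial_comm_of_dual hQ hQ' hKi hLi (h.EF_self i) (h.EF_comm hij.symm) hK' hL'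
        (Nat.lt_succ_iff.mp (Finset.mem_range.mp hs)), smul_add, smul_smul, smul_smul]]
    rw [Finset.sum_add_distrib, Finset.sum_range_succ, Finset.sum_range_succ']
    simp only [sub_self, Nat.cast_zero, quantumInt_zero, mul_zero, zero_smul, add_zero]
    rw [← Finset.sum_add_distrib]
    refine Finset.sum_eq_zero fun s hs => ?_
    have e₁ : m - (s + 1) = m - 1 - s := by omega
    have e₂ : 1 - ((s : ℤ) + 1) = -s := by ring
    push_cast
    rw [e₁, e₂, add_sub_cancel_right, ← add_smul]
    have := hrec s (Finset.mem_range.mp hs)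
    rw [show ((-1 : Kq) ^ s * qbinom d i m s * ((qi d i - (qi d i)⁻¹)⁻¹ *
      quantumInt (qi d i) (m - s)) + (-1) ^ (s + 1) * qbinom d i m (s + 1) *
      ((qi d i - (qi d i)⁻¹)⁻¹ * quantumInt (qi d i) (s + 1))) = 0 by
        linear_combination ((-1 : Kq) ^ s * (qi d i - (qi d i)⁻¹)⁻¹) * this, zero_smul]
  by_cases hl' : l = j
  · subst l
    have hK' : SkewComm (qi d i ^ (1 - m : ℤ)) (K j) (E i) := by
      rw [← ha, ← hC.qi_zpow_symm]; exact h.KE j i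
    have hL' : SkewComm (qi d i ^ (-(1 - m : ℤ))) (L j) (E i) := by
      rw [← ha, zpow_neg, ← hC.qi_zpow_symm, ← zpow_neg]; exact h.LE j i
    have hnz := qint_ne_zero (hC.d_pos i) (m := m) (by exact_mod_cast hm1)
    have s₁ := sum_quantum_binomial_eq_zero hQ hnz hrec
    have s₂ := sum_quantum_binomial_eq_zero (inv_ne_zero hQ) (m := m) (c := qbinom d i m)
      (by rwa [quantumInt_inv]) (by simpa only [quantumInt_inv] using hrec)
    rw [Finset.sum_congr rfl fun s hs => by
      rw [serreMonomial_comm_of_dual' hK' hL' (h.EF_self j) (h.EF_comm hij)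
        (Nat.lt_succ_iff.mp (Finset.mem_range.mp hs)), smul_sub, smul_smul, smul_smul,
        mul_left_comm, mul_left_comm _ _ ((qi d i)⁻¹ ^ _)]]
    rw [Finset.sum_sub_distrib, ← Finset.sum_smul, ← Finset.sum_smul, ← Finset.mul_sum,
      ← Finset.mul_sum, s₁, s₂]
    simp
  · refine Finset.sum_eq_zero fun s _ => ?_
    have hi : Commute (E i) (F l) := h.EF_comm (Ne.symm hl)
    have hj : Commute (E j) (F l) := h.EF_comm (Ne.symm hl')
    rw [(((hi.pow_left _).mul_left hj).mul_left (hi.pow_left _)).eq, sub_self, smul_zero]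

end EFKRel

/-- An element skew-commuting with every `X l` skew-commutes with the Serre elements in `X`. -/
theorem SkewComm.serreElt {R : Type*} [Ring R] [Algebra Kq R] (a : Fin n → Fin n → ℤ)
    (d : Fin n → ℕ) {X : Fin n → R} {x : R} {c : Fin n → Kq} (h : ∀ l, SkewComm (c l) x (X l))
    (i j : Fin n) :
    SkewComm (c i ^ (1 - a i j).toNat * c j) x (_root_.serreElt a d X i j) := by
  unfold SkewComm _root_.serreElt
  rw [Finset.mul_sum, Finset.sum_mul, Finset.smul_sum]
  refine Finset.sum_congr rfl fun s hs => ?_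
  have hs' : s ≤ (1 - a i j).toNat := Nat.lt_succ_iff.mp (Finset.mem_range.mp hs)
  have := (((h i).pow_right ((1 - a i j).toNat - s)).mul_right (h j)).mul_right
    ((h i).pow_right s)
  rw [mul_smul_comm, this, smul_mul_assoc, smul_comm, mul_right_comm, ← pow_add,
    Nat.sub_add_cancel hs']

/-! ### Inducing a representation to words in the `F`'s -/

theorem CartanData.prod_qi_zpow {a : Fin n → Fin n → ℤ} {d r : Fin n → ℕ}
    (hC : CartanData n a d r) (j : Fin n) :
    ((List.finRange n).map fun i => (qi d i ^ (-a i j)) ^ r i).prod = 1 := by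
  have key : ∀ l : List (Fin n), (l.map fun i => (qi d i ^ (-a i j)) ^ r i).prod =
      qvar ^ (-(l.map fun i => (r i : ℤ) * d i * a i j).sum) := by
    intro l
    induction l with
    | nil => simp
    | cons i l ih =>
      rw [List.map_cons, List.prod_cons, ih, qi_zpow, ← zpow_natCast, ← zpow_mul,
        ← zpow_add₀ qvar_ne_zero, List.map_cons, List.sum_cons]
      congr 1
      ring
  have hnull := hC.null j
  rw [Fin.sum_univ_def] at hnull
  rw [key, hnull, neg_zero, zpow_zero]

section Words

variable {B : Type*} [AddCommGroup B] [Module Kq B]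

/-- Prepend the letter `i` to each word. -/
def wordF (B : Type*) [AddCommGroup B] [Module Kq B] (i : Fin n) :
    Module.End Kq (List (Fin n) →₀ B) :=
  Finsupp.lsum Kq fun w => Finsupp.lsingle (i :: w)

/-- Act by `x` on the coefficients and scale each word by the product of the scalars `c` of its
letters. -/
def wordDiag (c : Fin n → Kq) (x : Module.End Kq B) : Module.End Kq (List (Fin n) →₀ B) :=
  Finsupp.lsum Kq fun w => (w.map c).prod • (Finsupp.lsingle w ∘ₗ x)

@[simp]
theorem wordF_single (i : Fin n) (w : List (Fin n)) (b : B) :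
    wordF B i (Finsupp.single w b) = Finsupp.single (i :: w) b := by
  simp [wordF]

@[simp]
theorem wordDiag_single (c : Fin n → Kq) (x : Module.End Kq B) (w : List (Fin n)) (b : B) :
    wordDiag c x (Finsupp.single w b) = (w.map c).prod • Finsupp.single w (x b) := by
  simp [wordDiag]

/-- Two operators agreeing on the empty word and commuting in the same way with all `wordF` are
equal. -/
theorem word_end_ext {X Y : Module.End Kq (List (Fin n) →₀ B)} {c : Fin n → Kq}
    (h : ∀ b, X (Finsupp.single [] b) = Y (Finsupp.single [] b))
    (hXY : ∀ i, SkewComm (c i) (X - Y) (wordF B i)) : X = Y := by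
  rw [← sub_eq_zero]
  ext w b : 2
  simp only [LinearMap.comp_apply, Finsupp.lsingle_apply]
  induction w with
  | nil => simp [h b]
  | cons i w ih =>
    have := LinearMap.congr_fun (hXY i) (Finsupp.single w b)
    rw [Module.End.mul_apply, wordF_single, LinearMap.smul_apply, Module.End.mul_apply, ih] at this
    simpa using this

/-- `wordDiag` as a monoid homomorphism. -/
def wordDiagHom (B : Type*) [AddCommGroup B] [Module Kq B] :
    (Fin n → Kq) × Module.End Kq B →* Module.End Kq (List (Fin n) →₀ B) where
  toFun p := wordDiag p.1 p.2
  map_one' := by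
    ext w b : 2
    simp [Pi.one_def]
  map_mul' p p' := by
    ext w b : 2
    have : (w.map (p * p').1).prod = (w.map p.1).prod * (w.map p'.1).prod :=
      List.prod_map_mul
    simp only [LinearMap.comp_apply, Finsupp.lsingle_apply, Module.End.mul_apply, wordDiag_single,
      map_smul, smul_smul, this, mul_comm (w.map p'.1).prod]
    rfl

theorem wordDiag_mul (c c' : Fin n → Kq) (x x' : Module.End Kq B) :
    wordDiag c x * wordDiag c' x' = wordDiag (c * c') (x * x') :=
  (map_mul (wordDiagHom B) (c, x) (c', x')).symm

theorem wordDiag_one : wordDiag (1 : Fin n → Kq) (1 : Module.End Kq B) = 1 :=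
  map_one (wordDiagHom B)

theorem wordDiag_skewComm (c : Fin n → Kq) (x : Module.End Kq B) (i : Fin n) :
    SkewComm (c i) (wordDiag c x) (wordF B i) := by
  unfold SkewComm
  ext w b : 2
  simp [mul_smul]

/-- The relations of the positive Borel part of `U_q`, without the Serre relations. -/
structure BorelRel {R : Type*} [Ring R] [Algebra Kq R] (a : Fin n → Fin n → ℤ) (d r : Fin n → ℕ)
    (e k l : Fin n → R) (g h : R) : Prop where
  kl : ∀ i, k i * l i = 1
  lk : ∀ i, l i * k i = 1
  gh : g * h = 1
  hg : h * g = 1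
  ge : ∀ i, g * e i = e i * g
  gk : ∀ i, g * k i = k i * g
  gl : ∀ i, g * l i = l i * g
  gsq : g * g = ((List.finRange n).map fun i => k i ^ r i).prod
  kk : ∀ i j, k i * k j = k j * k i
  ke : ∀ i j, SkewComm (qi d i ^ a i j) (k i) (e j)

variable (a : Fin n → Fin n → ℤ) (d r : Fin n → ℕ) (e k l : Fin n → Module.End Kq B)
  (g h : Module.End Kq B)

/-- The action of `K_i` on words. -/
def wordK (i : Fin n) : Module.End Kq (List (Fin n) →₀ B) :=
  wordDiag (fun j => qi d i ^ (-a i j)) (k i)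

/-- The action of `K_i⁻¹` on words. -/
def wordL (i : Fin n) : Module.End Kq (List (Fin n) →₀ B) :=
  wordDiag (fun j => qi d i ^ a i j) (l i)

/-- The action of `E_i` on a single word, obtained by commuting `E_i` to the right. -/
def wordEAux (i : Fin n) : List (Fin n) → B →ₗ[Kq] (List (Fin n) →₀ B)
  | [] => Finsupp.lsingle [] ∘ₗ e i
  | j :: w => wordF B j ∘ₗ wordEAux i w + if i = j then
      ((qi d i - (qi d i)⁻¹)⁻¹ • (wordK a d k i - wordL a d l i)) ∘ₗ Finsupp.lsingle w else 0

/-- The action of `E_i` on words. -/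
def wordE (i : Fin n) : Module.End Kq (List (Fin n) →₀ B) :=
  Finsupp.lsum Kq (wordEAux a d e k l i)

theorem wordE_single_nil (i : Fin n) (b : B) :
    wordE a d e k l i (Finsupp.single [] b) = Finsupp.single [] (e i b) := by
  simp [wordE, wordEAux]

theorem wordE_wordF (i j : Fin n) :
    wordE a d e k l i * wordF B j - wordF B j * wordE a d e k l i =
      if i = j then (qi d i - (qi d i)⁻¹)⁻¹ • (wordK a d k i - wordL a d l i) else 0 := by
  ext w b : 2
  split_ifs with hij <;> simp [wordE, wordEAux, hij]

variable {a d r e k l g h}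

theorem BorelRel.word_KE (H : BorelRel a d r e k l g h) (i j : Fin n) :
    SkewComm (qi d i ^ a i j) (wordK a d k i) (wordE a d e k l j) := by
  have hEF : ∀ m, wordE a d e k l j * wordF B m = wordF B m * wordE a d e k l j +
      if j = m then (qi d j - (qi d j)⁻¹)⁻¹ • (wordK a d k j - wordL a d l j) else 0 := by
    intro m; rw [← wordE_wordF]; abel
  have hKF : ∀ m, wordK a d k i * wordF B m = qi d i ^ (-a i m) • (wordF B m * wordK a d k i) :=
    fun m => wordDiag_skewComm _ (k i) m
  have hKK : wordK a d k i * wordK a d k j = wordK a d k j * wordK a d k i := by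
    rw [wordK, wordK, wordDiag_mul, wordDiag_mul, H.kk, mul_comm]
  have hkl : k i * l j = l j * k i := by
    have : k i * l j = l j * (k j * k i) * l j := by rw [← mul_assoc, H.lk, one_mul]
    rw [this, H.kk, mul_assoc, mul_assoc, H.kl, mul_one]
  have hKL : wordK a d k i * wordL a d l j = wordL a d l j * wordK a d k i := by
    rw [wordK, wordL, wordDiag_mul, wordDiag_mul, hkl, mul_comm]
  set κ := (qi d j - (qi d j)⁻¹)⁻¹
  refine word_end_ext (c := fun m => qi d i ^ (-a i m)) (fun b => ?_) fun m => ?_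
  · have := LinearMap.congr_fun (H.ke i j) b
    simp only [Module.End.mul_apply, LinearMap.smul_apply] at this
    simp [wordE_single_nil, wordK, this]
  · have hX : wordK a d k i * wordE a d e k l j * wordF B m =
        qi d i ^ (-a i m) • (wordF B m * (wordK a d k i * wordE a d e k l j)) +
        wordK a d k i * if j = m then κ •
          (wordK a d k j - wordL a d l j) else 0 := by
      rw [mul_assoc, hEF, mul_add, ← mul_assoc, hKF, smul_mul_assoc, mul_assoc]
    have hY : wordE a d e k l j * wordK a d k i * wordF B m =
        qi d i ^ (-a i m) • (wordF B m * (wordE a d e k l j * wordK a d k i)) +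
        qi d i ^ (-a i m) • ((if j = m then κ •
          (wordK a d k j - wordL a d l j) else 0) * wordK a d k i) := by
      rw [mul_assoc, hKF, mul_smul_comm, ← mul_assoc, hEF, add_mul, smul_add, mul_assoc]
    unfold SkewComm
    rw [sub_mul, hX, smul_mul_assoc, hY, mul_sub, mul_smul_comm, smul_add,
      smul_sub (qi d i ^ (-a i m)),
      smul_comm (qi d i ^ (-a i m)) (qi d i ^ a i j)]
    have hz : (wordK a d k i * if j = m then κ •
          (wordK a d k j - wordL a d l j) else 0) =
        qi d i ^ a i j • qi d i ^ (-a i m) • ((if j = m then κ •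
          (wordK a d k j - wordL a d l j) else 0) * wordK a d k i) := by
      split_ifs with hjm
      · rw [smul_smul, ← zpow_add₀ (qi_ne_zero d i), hjm, add_neg_cancel, zpow_zero, one_smul,
          ← hjm, mul_smul_comm, smul_mul_assoc, mul_sub, sub_mul, hKK, hKL]
      · simp
    rw [hz]
    abel

theorem BorelRel.word_efkRel (H : BorelRel a d r e k l g h) :
    EFKRel a d (wordE a d e k l) (wordF B) (wordK a d k) (wordL a d l) where
  KL i := by
    rw [wordK, wordL, wordDiag_mul, H.kl, ← wordDiag_one]
    congr 1
    ext j
    simp [zpow_ne_zero _ (qi_ne_zero d i)]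
  LK i := by
    rw [wordK, wordL, wordDiag_mul, H.lk, ← wordDiag_one]
    congr 1
    ext j
    simp [zpow_ne_zero _ (qi_ne_zero d i)]
  KE := H.word_KE
  KF i j := wordDiag_skewComm _ (k i) j
  EF := wordE_wordF a d e k l

theorem BorelRel.word_gE (H : BorelRel a d r e k l g h) (i : Fin n) :
    wordDiag 1 g * wordE a d e k l i = wordE a d e k l i * wordDiag 1 g := by
  have hEF : ∀ m, wordE a d e k l i * wordF B m = wordF B m * wordE a d e k l i +
      if i = m then (qi d i - (qi d i)⁻¹)⁻¹ • (wordK a d k i - wordL a d l i) else 0 := by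
    intro m; rw [← wordE_wordF]; abel
  have hgF : ∀ m : Fin n, wordDiag 1 g * wordF B m = wordF B m * wordDiag 1 g :=
    fun m => by simpa [SkewComm] using wordDiag_skewComm 1 g m
  have hgK : wordDiag 1 g * wordK a d k i = wordK a d k i * wordDiag 1 g := by
    rw [wordK, wordDiag_mul, wordDiag_mul, H.gk, mul_comm]
  have hgL : wordDiag 1 g * wordL a d l i = wordL a d l i * wordDiag 1 g := by
    rw [wordL, wordDiag_mul, wordDiag_mul, H.gl, mul_comm]
  refine word_end_ext (c := 1) (fun b => ?_) fun m => ?_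
  · have := LinearMap.congr_fun (H.ge i) b
    simp only [Module.End.mul_apply] at this
    simp [wordE_single_nil, this]
  · rw [SkewComm, Pi.one_apply, one_smul, sub_mul, mul_sub, mul_assoc, hEF, mul_add, mul_assoc, hgF,
      ← mul_assoc, hgF, ← mul_assoc, hEF, add_mul, mul_assoc, mul_assoc]
    split_ifs
    · rw [mul_smul_comm, smul_mul_assoc, mul_sub, sub_mul, hgK, hgL]
      abel
    · simp

theorem BorelRel.word_serreE (H : BorelRel a d r e k l g h) (hC : CartanData n a d r)
    {i j : Fin n} (hij : i ≠ j) (hs : serreElt a d e i j = 0) :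
    serreElt a d (wordE a d e k l) i j = 0 := by
  refine word_end_ext (c := 1) (fun b => ?_) fun m => ?_
  · have hpow : ∀ (i : Fin n) (p : ℕ) (b : B),
        (wordE a d e k l i ^ p) (Finsupp.single [] b) = Finsupp.single [] ((e i ^ p) b) := by
      intro i p
      induction p with
      | zero => simp
      | succ p ih => intro b; simp [pow_succ, wordE_single_nil, ih]
    have := congrArg (Finsupp.lsingle (R := Kq) ([] : List (Fin n))) (LinearMap.congr_fun hs b)
    simp only [serreElt, LinearMap.sum_apply, map_sum, LinearMap.smul_apply, map_smul,
      Module.End.mul_apply] at this ⊢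
    simpa [hpow, wordE_single_nil] using this
  · simpa [SkewComm] using H.word_efkRel.serreElt_comm hC hij m

theorem BorelRel.word_gsq (H : BorelRel a d r e k l g h) (hC : CartanData n a d r) :
    (wordDiag 1 g * wordDiag 1 g : Module.End Kq (List (Fin n) →₀ B)) =
      ((List.finRange n).map fun i => wordK a d k i ^ r i).prod := by
  have : ((List.finRange n).map fun i => wordK a d k i ^ r i) =
      ((List.finRange n).map fun i =>
        (((fun j => qi d i ^ (-a i j)), k i) : (Fin n → Kq) × Module.End Kq B) ^ r i).map
          (wordDiagHom B) := by
    rw [List.map_map]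
    refine List.map_congr_left fun i _ => ?_
    rw [Function.comp_apply, map_pow]
    rfl
  rw [this, ← map_list_prod, wordDiag_mul, H.gsq, mul_one]
  have hfst : ∀ (l : List (Fin n)) (j : Fin n), (l.map fun i =>
      (((fun j => qi d i ^ (-a i j)), k i) : (Fin n → Kq) × Module.End Kq B) ^ r i).prod.1 j =
        (l.map fun i => (qi d i ^ (-a i j)) ^ r i).prod := by
    intro l j
    induction l with
    | nil => rfl
    | cons i l ih => simp only [List.map_cons, List.prod_cons, Prod.fst_mul, Pi.mul_apply, ih,
        Prod.pow_fst, Pi.pow_apply]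
  have hsnd : ∀ l : List (Fin n), (l.map fun i =>
      (((fun j => qi d i ^ (-a i j)), k i) : (Fin n → Kq) × Module.End Kq B) ^ r i).prod.2 =
        (l.map fun i => k i ^ r i).prod := by
    intro l
    induction l with
    | nil => rfl
    | cons i l ih => simp only [List.map_cons, List.prod_cons, Prod.snd_mul, ih, Prod.pow_snd]
  have hp : (1, ((List.finRange n).map fun i => k i ^ r i).prod) =
      ((List.finRange n).map fun i =>
        (((fun j => qi d i ^ (-a i j)), k i) : (Fin n → Kq) × Module.End Kq B) ^ r i).prod := by
    refine Prod.ext (funext fun j => ?_) (hsnd _).symm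
    rw [hfst, hC.prod_qi_zpow]
    rfl
  rw [← hp]
  rfl


/-- The span of all words in the `F`'s applied to multiples of Serre elements. -/
def serreSubmodule (B : Type*) [AddCommGroup B] [Module Kq B] (a : Fin n → Fin n → ℤ)
    (d : Fin n → ℕ) : Submodule Kq (List (Fin n) →₀ B) :=
  Submodule.span Kq {x | ∃ (w : List (Fin n)) (i j : Fin n) (v : List (Fin n) →₀ B), i ≠ j ∧
    x = (w.map (wordF B)).prod (serreElt a d (wordF B) i j v)}

variable (a d) in
theorem serreElt_mem_serreSubmodule {i j : Fin n} (hij : i ≠ j) (v : List (Fin n) →₀ B) :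
    serreElt a d (wordF B) i j v ∈ serreSubmodule B a d :=
  Submodule.subset_span ⟨[], i, j, v, hij, by simp⟩

theorem serreSubmodule_le_comap {X : Module.End Kq (List (Fin n) →₀ B)}
    (hS : ∀ i j, i ≠ j → ∀ v, X (serreElt a d (wordF B) i j v) ∈ serreSubmodule B a d)
    (hF : ∀ m, ∀ x ∈ serreSubmodule B a d, X x ∈ serreSubmodule B a d →
      X (wordF B m x) ∈ serreSubmodule B a d) :
    serreSubmodule B a d ≤ (serreSubmodule B a d).comap X := by
  refine Submodule.span_le.mpr ?_
  rintro _ ⟨w, i, j, v, hij, rfl⟩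
  simp only [Submodule.comap_coe, Set.mem_preimage, SetLike.mem_coe]
  induction w with
  | nil => simpa using hS i j hij v
  | cons m w ih =>
    rw [List.map_cons, List.prod_cons, Module.End.mul_apply]
    exact hF m _ (Submodule.subset_span ⟨w, i, j, v, hij, rfl⟩) ih

theorem wordF_mem_serreSubmodule (m : Fin n) {x : List (Fin n) →₀ B}
    (hx : x ∈ serreSubmodule B a d) : wordF B m x ∈ serreSubmodule B a d := by
  revert x
  change serreSubmodule B a d ≤ (serreSubmodule B a d).comap (wordF B m)
  refine Submodule.span_le.mpr ?_
  rintro _ ⟨w, i, j, v, hij, rfl⟩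
  exact Submodule.subset_span ⟨m :: w, i, j, v, hij, by simp⟩

theorem wordDiag_mem_serreSubmodule (c : Fin n → Kq) (y : Module.End Kq B)
    {x : List (Fin n) →₀ B} (hx : x ∈ serreSubmodule B a d) :
    wordDiag c y x ∈ serreSubmodule B a d := by
  revert x
  change serreSubmodule B a d ≤ (serreSubmodule B a d).comap (wordDiag c y)
  refine serreSubmodule_le_comap (fun i j hij v => ?_) fun m x _ hx => ?_
  · have := LinearMap.congr_fun (SkewComm.serreElt a d (wordDiag_skewComm c y) i j) v
    rw [← Module.End.mul_apply, this]
    exact Submodule.smul_mem _ _ (serreElt_mem_serreSubmodule a d hij _)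
  · have := LinearMap.congr_fun (wordDiag_skewComm c y m) x
    rw [← Module.End.mul_apply, this]
    exact Submodule.smul_mem _ _ (wordF_mem_serreSubmodule m hx)

theorem BorelRel.wordE_mem_serreSubmodule (H : BorelRel a d r e k l g h)
    (hC : CartanData n a d r) (i : Fin n) {x : List (Fin n) →₀ B}
    (hx : x ∈ serreSubmodule B a d) : wordE a d e k l i x ∈ serreSubmodule B a d := by
  revert x
  change serreSubmodule B a d ≤ (serreSubmodule B a d).comap (wordE a d e k l i)
  refine serreSubmodule_le_comap (fun p q hpq v => ?_) fun m x hx hEx => ?_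
  · rw [← Module.End.mul_apply, ← H.word_efkRel.swap.serreElt_comm hC hpq]
    exact serreElt_mem_serreSubmodule a d hpq _
  · have := LinearMap.congr_fun (wordE_wordF a d e k l i m) x
    rw [LinearMap.sub_apply, Module.End.mul_apply, sub_eq_iff_eq_add] at this
    rw [this]
    refine add_mem ?_ (wordF_mem_serreSubmodule m hEx)
    split_ifs
    · exact Submodule.smul_mem _ _ (sub_mem (wordDiag_mem_serreSubmodule _ _ hx)
        (wordDiag_mem_serreSubmodule _ _ hx))
    · exact zero_mem _

variable (a d e k l g h)

/-- The operators on words attached to the generators of `U_q`. -/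
def wordOp : Gen n → Module.End Kq (List (Fin n) →₀ B)
  | .E i => wordE a d e k l i
  | .F i => wordF B i
  | .K i => wordK a d k i
  | .Kinv i => wordL a d l i
  | .g => wordDiag 1 g
  | .ginv => wordDiag 1 h

variable {a d e k l g h}

theorem BorelRel.wordOp_mem_serreSubmodule (H : BorelRel a d r e k l g h)
    (hC : CartanData n a d r) (x : Gen n) :
    serreSubmodule B a d ≤ (serreSubmodule B a d).comap (wordOp a d e k l g h x) := by
  intro v hv
  cases x with
  | E i => exact H.wordE_mem_serreSubmodule hC i hv
  | F i => exact wordF_mem_serreSubmodule i hv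
  | K i => exact wordDiag_mem_serreSubmodule _ _ hv
  | Kinv i => exact wordDiag_mem_serreSubmodule _ _ hv
  | g => exact wordDiag_mem_serreSubmodule _ _ hv
  | ginv => exact wordDiag_mem_serreSubmodule _ _ hv

/-- All relations of `U_q` except `F`-Serre hold for the operators on words. -/
theorem BorelRel.lift_wordOp_eq (H : BorelRel a d r e k l g h)
    (hC : CartanData n a d r) (hs : ∀ i j, i ≠ j → serreElt a d e i j = 0) {u u' : FA n}
    (huu' : QRel a d r u u') :
    FreeAlgebra.lift Kq (wordOp a d e k l g h) u = FreeAlgebra.lift Kq (wordOp a d e k l g h) u' ∨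
      u' = 0 ∧ ∃ i j, i ≠ j ∧ u = serreF a d i j := by
  have hι : ∀ x, FreeAlgebra.lift Kq (wordOp a d e k l g h) (ι x) = wordOp a d e k l g h x :=
    fun x => FreeAlgebra.lift_ι_apply _ _
  have hgh : (wordDiag 1 g * wordDiag 1 h : Module.End Kq (List (Fin n) →₀ B)) = 1 := by
    rw [wordDiag_mul, H.gh, mul_one, wordDiag_one]
  have hhg : (wordDiag 1 h * wordDiag 1 g : Module.End Kq (List (Fin n) →₀ B)) = 1 := by
    rw [wordDiag_mul, H.hg, mul_one, wordDiag_one]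
  have R := H.word_efkRel
  induction huu' with
  | KKinv i => left; simpa [hι, wordOp] using R.KL i
  | KinvK i => left; simpa [hι, wordOp] using R.LK i
  | gginv => left; simpa [hι, wordOp] using hgh
  | ginvg => left; simpa [hι, wordOp] using hhg
  | gcomm x =>
    left
    rw [map_mul, map_mul, hι, hι]
    cases x with
    | E i => exact H.word_gE i
    | F i => simpa [SkewComm, wordOp] using wordDiag_skewComm (B := B) 1 g i
    | K i => simp only [wordOp, wordK, wordDiag_mul, H.gk, mul_comm]
    | Kinv i => simp only [wordOp, wordL, wordDiag_mul, H.gl, mul_comm]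
    | g => rfl
    | ginv => exact hgh.trans hhg.symm
  | gsq =>
    left
    rw [map_mul, hι, map_list_prod, List.map_map]
    refine (H.word_gsq hC).trans (congrArg List.prod (List.map_congr_left fun i _ => ?_))
    rw [Function.comp_apply, map_pow, hι]
    rfl
  | KK i j =>
    left
    rw [map_mul, map_mul, hι, hι]
    simp only [wordOp, wordK, wordDiag_mul, H.kk i j, mul_comm]
  | KE i j => left; simpa [hι, wordOp, SkewComm] using R.KE i j
  | KF i j => left; simpa [hι, wordOp, SkewComm] using R.KF i j
  | EF i j =>
    left
    rw [map_sub, map_mul, map_mul, hι, hι]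
    refine (R.EF i j).trans ?_
    split_ifs <;> simp [hι, wordOp]
  | serreEE i j hij =>
    left
    rw [map_zero, ← H.word_serreE hC hij (hs i j hij)]
    exact (map_serreElt _ a d (fun i => ι (Gen.E i)) i j).trans (by simp only [hι, wordOp])
  | serreFF i j hij => exact Or.inr ⟨rfl, i, j, hij, rfl⟩

/-- The representation of `U_q` on words modulo the Serre relations. -/
theorem BorelRel.exists_rep (H : BorelRel a d r e k l g h)
    (hC : CartanData n a d r) (hs : ∀ i j, i ≠ j → serreElt a d e i j = 0) :
    ∃ ρ : Uq a d r →ₐ[Kq] Module.End Kq ((List (Fin n) →₀ B) ⧸ serreSubmodule B a d),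
      ∀ (x : Gen n) (v : List (Fin n) →₀ B), ρ (gen a d r x) (Submodule.Quotient.mk v) =
        Submodule.Quotient.mk (wordOp a d e k l g h x v) := by
  set N := serreSubmodule B a d
  let σ : FA n →ₐ[Kq] Module.End Kq ((List (Fin n) →₀ B) ⧸ N) := FreeAlgebra.lift Kq fun x =>
    N.mapQ N (wordOp a d e k l g h x) (H.wordOp_mem_serreSubmodule hC x)
  have hσ : ∀ (u : FA n) (v : List (Fin n) →₀ B), σ u (Submodule.Quotient.mk v) =
      Submodule.Quotient.mk (FreeAlgebra.lift Kq (wordOp a d e k l g h) u v) := by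
    intro u
    induction u using FreeAlgebra.induction with
    | grade0 c => intro v; simp [Module.algebraMap_end_apply]
    | grade1 x => intro v; simp [σ]
    | mul x y hx hy => intro v; simp [hx, hy]
    | add x y hx hy => intro v; simp [hx, hy]
  have hrel : ∀ ⦃u u' : FA n⦄, QRel a d r u u' → σ u = σ u' := by
    intro u u' huu'
    refine Submodule.linearMap_qext _ (LinearMap.ext fun v => ?_)
    simp only [LinearMap.comp_apply, Submodule.mkQ_apply, hσ]
    rcases H.lift_wordOp_eq hC hs huu' with h | ⟨rfl, i, j, hij, rfl⟩
    · rw [h]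
    · rw [map_zero, LinearMap.zero_apply, Submodule.Quotient.mk_zero,
        Submodule.Quotient.mk_eq_zero]
      have : FreeAlgebra.lift Kq (wordOp a d e k l g h) (serreF a d i j) =
          serreElt a d (wordF B) i j :=
        (map_serreElt _ a d (fun i => ι (Gen.F i)) i j).trans (by
          simp only [ι, FreeAlgebra.lift_ι_apply, wordOp])
      rw [this]
      exact serreElt_mem_serreSubmodule a d hij v
  refine ⟨RingQuot.liftAlgHom Kq ⟨σ, hrel⟩, fun x v => ?_⟩
  rw [gen, RingQuot.liftAlgHom_mkAlgHom_apply, hσ, ι, FreeAlgebra.lift_ι_apply]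

end Words

/-! ### The torus and the positive Borel part -/

/-- Generators of the torus. -/
inductive TorusGen (n : ℕ) : Type
  | K : Fin n → TorusGen n
  | Kinv : Fin n → TorusGen n
  | g : TorusGen n
  | ginv : TorusGen n

/-- Relations of the torus. -/
inductive TorusRel (r : Fin n → ℕ) :
    FreeAlgebra Kq (TorusGen n) → FreeAlgebra Kq (TorusGen n) → Prop
  | comm (x y : TorusGen n) : TorusRel r (FreeAlgebra.ι Kq x * FreeAlgebra.ι Kq y)
      (FreeAlgebra.ι Kq y * FreeAlgebra.ι Kq x)
  | KKinv (i : Fin n) : TorusRel r (FreeAlgebra.ι Kq (.K i) * FreeAlgebra.ι Kq (.Kinv i)) 1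
  | gginv : TorusRel r (FreeAlgebra.ι Kq .g * FreeAlgebra.ι Kq .ginv) 1
  | gsq : TorusRel r (FreeAlgebra.ι Kq .g * FreeAlgebra.ι Kq .g)
      ((List.finRange n).map fun i => FreeAlgebra.ι Kq (.K i) ^ r i).prod

/-- The torus: the abstract commutative algebra on `K_i^{±1}`, `γ^{±1/2}`. -/
abbrev Torus (r : Fin n → ℕ) : Type := RingQuot (TorusRel r)

/-- The relations of the torus for a family of elements of an arbitrary algebra. -/
structure IsTorusFamily {R : Type*} [Ring R] (r : Fin n → ℕ) (f : TorusGen n → R) : Prop where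
  comm : ∀ x y, f x * f y = f y * f x
  K_mul_Kinv : ∀ i, f (.K i) * f (.Kinv i) = 1
  g_mul_ginv : f .g * f .ginv = 1
  g_mul_g : f .g * f .g = ((List.finRange n).map fun i => f (.K i) ^ r i).prod

/-- The scalar by which commuting past `E_j` changes a generator of the torus. -/
def torusScalar (a : Fin n → Fin n → ℤ) (d : Fin n → ℕ) (j : Fin n) : TorusGen n → Kq
  | .K i => qi d i ^ (-a i j)
  | .Kinv i => qi d i ^ a i j
  | .g => 1
  | .ginv => 1

theorem IsTorusFamily.twist {R : Type*} [Ring R] [Algebra Kq R] {a : Fin n → Fin n → ℤ}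
    {d r : Fin n → ℕ} {f : TorusGen n → R} (hf : IsTorusFamily r f) (hC : CartanData n a d r)
    (j : Fin n) : IsTorusFamily r fun x => torusScalar a d j x • f x where
  comm x y := by
    simp only [smul_mul_assoc, mul_smul_comm, hf.comm x y]
    rw [smul_comm]
  K_mul_Kinv i := by
    simp only [smul_mul_assoc, mul_smul_comm, hf.K_mul_Kinv, torusScalar, smul_smul]
    rw [← zpow_add₀ (qi_ne_zero d i), add_neg_cancel, zpow_zero, one_smul]
  g_mul_ginv := by simp [torusScalar, hf.g_mul_ginv]
  g_mul_g := by
    have key : ∀ l : List (Fin n),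
        (l.map fun i => (torusScalar a d j (.K i) • f (.K i)) ^ r i).prod =
          (l.map fun i => (qi d i ^ (-a i j)) ^ r i).prod •
            (l.map fun i => f (.K i) ^ r i).prod := by
      intro l
      induction l with
      | nil => simp
      | cons i l ih =>
        rw [List.map_cons, List.prod_cons, ih, List.map_cons, List.prod_cons, List.map_cons,
          List.prod_cons, smul_pow, smul_mul_smul_comm, torusScalar]
    rw [key, hC.prod_qi_zpow, one_smul, ← hf.g_mul_g]
    simp [torusScalar]

namespace Torus

variable {r : Fin n → ℕ}

/-- The generators of the torus. -/
def of (r : Fin n → ℕ) (x : TorusGen n) : Torus r :=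
  RingQuot.mkAlgHom Kq (TorusRel r) (FreeAlgebra.ι Kq x)

theorem isTorusFamily_of : IsTorusFamily r (of r) where
  comm x y := by simpa [of] using RingQuot.mkAlgHom_rel Kq (TorusRel.comm (r := r) x y)
  K_mul_Kinv i := by simpa [of] using RingQuot.mkAlgHom_rel Kq (TorusRel.KKinv (r := r) i)
  g_mul_ginv := by simpa [of] using RingQuot.mkAlgHom_rel Kq (TorusRel.gginv (r := r))
  g_mul_g := by
    simpa [of, map_list_prod, Function.comp_def] using
      RingQuot.mkAlgHom_rel Kq (TorusRel.gsq (r := r))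

theorem exists_lift {R : Type*} [Ring R] [Algebra Kq R] {f : TorusGen n → R}
    (hf : IsTorusFamily r f) : ∃ φ : Torus r →ₐ[Kq] R, ∀ x, φ (of r x) = f x := by
  refine ⟨RingQuot.liftAlgHom Kq ⟨FreeAlgebra.lift Kq f, ?_⟩, fun x => ?_⟩
  · intro u u' h
    induction h with
    | comm x y => simpa using hf.comm x y
    | KKinv i => simpa using hf.K_mul_Kinv i
    | gginv => simpa using hf.g_mul_ginv
    | gsq => simpa [map_list_prod, Function.comp_def] using hf.g_mul_g
  · rw [of, RingQuot.liftAlgHom_mkAlgHom_apply, FreeAlgebra.lift_ι_apply]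

theorem algHom_ext {R : Type*} [Ring R] [Algebra Kq R] {φ ψ : Torus r →ₐ[Kq] R}
    (h : ∀ x, φ (of r x) = ψ (of r x)) : φ = ψ :=
  RingQuot.ringQuot_ext' Kq _ _ (FreeAlgebra.hom_ext (funext h))

/-- Commuting past the `E_j` is given by commuting endomorphisms of the torus. -/
theorem exists_twist {a : Fin n → Fin n → ℤ} {d : Fin n → ℕ} (hC : CartanData n a d r) :
    ∃ τ : Fin n → Torus r →ₐ[Kq] Torus r, (∀ j x, τ j (of r x) = torusScalar a d j x • of r x) ∧
      ∀ i j, (τ i).comp (τ j) = (τ j).comp (τ i) := by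
  choose τ hτ using fun j => exists_lift (isTorusFamily_of.twist hC j)
  refine ⟨τ, hτ, fun i j => algHom_ext fun x => ?_⟩
  simp only [AlgHom.comp_apply, hτ, map_smul]
  rw [smul_comm]

end Torus

section Borel

open TensorProduct

variable {a : Fin n → Fin n → ℤ} {d r : Fin n → ℕ} {T : Type*} [Ring T] [Algebra Kq T]
  {P : Type*} [Ring P] [Algebra Kq P]

/-- The action of `T` on `T ⊗ P` by multiplication. -/
def torusAct (T P : Type*) [Ring T] [Algebra Kq T] [AddCommGroup P] [Module Kq P] :
    T →ₐ[Kq] Module.End Kq (T ⊗[Kq] P) :=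
  (Module.End.rTensorAlgHom Kq T P).comp (Algebra.lmul Kq T)

theorem torusAct_tmul {P : Type*} [AddCommGroup P] [Module Kq P] (t t' : T) (z : P) :
    torusAct T P t (t' ⊗ₜ z) = (t * t') ⊗ₜ z := rfl

/-- `E_i` acts on `T ⊗ P` by twisting `T` and multiplying by `p i`. -/
def borelE (τ : Fin n → T →ₐ[Kq] T) (p : Fin n → P) (i : Fin n) : Module.End Kq (T ⊗[Kq] P) :=
  TensorProduct.map (τ i).toLinearMap (LinearMap.mulLeft Kq (p i))

variable {τ : Fin n → T →ₐ[Kq] T} {p : Fin n → P}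

theorem borelE_tmul (i : Fin n) (t : T) (z : P) :
    borelE τ p i (t ⊗ₜ z) = τ i t ⊗ₜ (p i * z) := rfl

theorem borelRel {f : TorusGen n → T} (hf : IsTorusFamily r f)
    (hτ : ∀ j x, τ j (f x) = torusScalar a d j x • f x) :
    BorelRel a d r (borelE τ p) (fun i => torusAct T P (f (.K i)))
      (fun i => torusAct T P (f (.Kinv i))) (torusAct T P (f .g)) (torusAct T P (f .ginv)) where
  kl i := by rw [← map_mul, hf.K_mul_Kinv, map_one]
  lk i := by rw [← map_mul, hf.comm, hf.K_mul_Kinv, map_one]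
  gh := by rw [← map_mul, hf.g_mul_ginv, map_one]
  hg := by rw [← map_mul, hf.comm, hf.g_mul_ginv, map_one]
  ge i := by
    refine TensorProduct.ext' fun t z => ?_
    simp [torusAct_tmul, borelE_tmul, hτ, torusScalar]
  gk i := by rw [← map_mul, hf.comm, map_mul]
  gl i := by rw [← map_mul, hf.comm, map_mul]
  gsq := by
    rw [← map_mul, hf.g_mul_g, map_list_prod, List.map_map]
    simp [Function.comp_def]
  kk i j := by rw [← map_mul, hf.comm, map_mul]
  ke i j := by
    refine TensorProduct.ext' fun t z => ?_
    simp only [Module.End.mul_apply, LinearMap.smul_apply, torusAct_tmul, borelE_tmul, map_mul, hτ,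
      torusScalar, smul_mul_assoc, smul_tmul', smul_smul]
    rw [← zpow_add₀ (qi_ne_zero d i), add_neg_cancel, zpow_zero, one_smul]

theorem borelE_serre {i j : Fin n} (hτ : (τ i).comp (τ j) = (τ j).comp (τ i))
    (hp : serreElt a d p i j = 0) : serreElt a d (borelE τ p) i j = 0 := by
  have hcomm : Commute ((τ i).toLinearMap : Module.End Kq T) (τ j).toLinearMap :=
    congrArg AlgHom.toLinearMap hτ
  have hmon : ∀ s ≤ (1 - a i j).toNat,
      borelE τ p i ^ ((1 - a i j).toNat - s) * borelE τ p j * borelE τ p i ^ s =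
      TensorProduct.map
        (((τ i).toLinearMap : Module.End Kq T) ^ (1 - a i j).toNat * (τ j).toLinearMap)
        (Algebra.lmul Kq P (p i ^ ((1 - a i j).toNat - s) * p j * p i ^ s)) := by
    intro s hs
    have e : ∀ i, LinearMap.mulLeft Kq (p i) = Algebra.lmul Kq P (p i) := fun _ => rfl
    rw [borelE, borelE, TensorProduct.map_pow, TensorProduct.map_pow, ← TensorProduct.map_mul,
      ← TensorProduct.map_mul, e, e, ← map_pow, ← map_pow, ← map_mul, ← map_mul, mul_assoc,
      ← (hcomm.pow_left s).eq, ← mul_assoc, ← pow_add, Nat.sub_add_cancel hs]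
  unfold serreElt at hp ⊢
  rw [Finset.sum_congr rfl fun s hs => by
    rw [hmon s (Nat.lt_succ_iff.mp (Finset.mem_range.mp hs)), ← TensorProduct.map_smul_right,
      ← map_smul]]
  have := congrArg (fun z => TensorProduct.map
    (((τ i).toLinearMap : Module.End Kq T) ^ (1 - a i j).toNat * (τ j).toLinearMap)
    (Algebra.lmul Kq P z)) hp
  simp only [map_sum, map_zero, TensorProduct.map_zero_right] at this
  rw [← this]
  exact (map_sum (TensorProduct.mapBilinear (RingHom.id Kq) T P T P
    (((τ i).toLinearMap : Module.End Kq T) ^ (1 - a i j).toNat * (τ j).toLinearMap)) _ _).symm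

end Borel

/-! ### Linear independence of the triangular products -/

/-- The generators of the torus as generators of `U_q`. -/
def TorusGen.toGen : TorusGen n → Gen n
  | .K i => .K i
  | .Kinv i => .Kinv i
  | .g => .g
  | .ginv => .ginv

section Evaluation

open TensorProduct

variable {B M N : Type*} [AddCommGroup B] [Module Kq B] [Ring M] [Algebra Kq M]
  [AddCommGroup N] [Module Kq N]

/-- Evaluate each word at the family `m`, and its coefficient by `π`. -/
def wordEval (m : Fin n → M) (π : B →ₗ[Kq] N) : (List (Fin n) →₀ B) →ₗ[Kq] M ⊗[Kq] N :=
  Finsupp.lsum Kq fun w => TensorProduct.mk Kq M N (w.map m).prod ∘ₗ π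

theorem wordEval_single (m : Fin n → M) (π : B →ₗ[Kq] N) (w : List (Fin n)) (b : B) :
    wordEval m π (Finsupp.single w b) = (w.map m).prod ⊗ₜ π b := by
  simp [wordEval]

theorem wordEval_wordF (m : Fin n → M) (π : B →ₗ[Kq] N) (i : Fin n) (v : List (Fin n) →₀ B) :
    wordEval m π (wordF B i v) = torusAct M N (m i) (wordEval m π v) := by
  induction v using Finsupp.induction_linear with
  | zero => simp
  | add v v' hv hv' => simp [hv, hv']
  | single w b => simp [wordEval_single, torusAct_tmul]

theorem wordEval_wordF_pow (m : Fin n → M) (π : B →ₗ[Kq] N) (i : Fin n) (p : ℕ)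
    (v : List (Fin n) →₀ B) :
    wordEval m π ((wordF B i ^ p) v) = (torusAct M N (m i) ^ p) (wordEval m π v) := by
  induction p with
  | zero => simp
  | succ p ih => rw [pow_succ', pow_succ', Module.End.mul_apply, wordEval_wordF, ih]; rfl

theorem serreSubmodule_le_ker_wordEval {a : Fin n → Fin n → ℤ} {d : Fin n → ℕ} {m : Fin n → M}
    (hm : ∀ i j, i ≠ j → serreElt a d m i j = 0) (π : B →ₗ[Kq] N) :
    serreSubmodule B a d ≤ LinearMap.ker (wordEval m π) := by
  refine Submodule.span_le.mpr ?_
  rintro _ ⟨w, i, j, v, hij, rfl⟩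
  rw [SetLike.mem_coe, LinearMap.mem_ker]
  induction w with
  | nil =>
    have := LinearMap.congr_fun (congrArg (torusAct M N) (hm i j hij)) (wordEval m π v)
    simp only [serreElt, map_sum, map_smul, map_mul, map_pow, map_zero] at this
    simpa [serreElt, wordEval_wordF_pow, wordEval_wordF] using this
  | cons l w ih =>
    rw [List.map_cons, List.prod_cons, Module.End.mul_apply, wordEval_wordF, ih, map_zero]

theorem intertwining_of_adjoin {A V W : Type*} [Ring A] [Algebra Kq A]
    [AddCommGroup V] [Module Kq V] [AddCommGroup W] [Module Kq W]
    {α : A →ₐ[Kq] Module.End Kq V} {β : A →ₐ[Kq] Module.End Kq W} {L : V →ₗ[Kq] W} {s : Set A}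
    (hs : Algebra.adjoin Kq s = ⊤) (h : ∀ x ∈ s, ∀ v, L (α x v) = β x (L v)) (x : A) :
    ∀ v, L (α x v) = β x (L v) := by
  have hx : x ∈ Algebra.adjoin Kq s := hs ▸ Algebra.mem_top
  induction hx using Algebra.adjoin_induction with
  | mem x hx => exact h x hx
  | algebraMap c => intro v; simp [Module.algebraMap_end_apply]
  | add x y _ _ hx hy => intro v; simp [hx, hy]
  | mul x y _ _ hx hy => intro v; simp [hx, hy]

variable {U T Z P : Type*} [Ring U] [Algebra Kq U] [Ring T] [Algebra Kq T] [Ring Z] [Algebra Kq Z]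
  [Ring P] [Algebra Kq P] {a : Fin n → Fin n → ℤ} {d r : Fin n → ℕ} {x : Gen n → U}
  {m : Fin n → M} {p : Fin n → P} {t : TorusGen n → T} {τ : Fin n → T →ₐ[Kq] T}

/-- Given a representation of `U` on words modulo Serre relations with coefficients in `T ⊗ P`,
evaluating its action on the unit inverts triangular multiplication. -/
theorem exists_left_inverse (φ : M →ₐ[Kq] U) (χ : T →ₐ[Kq] U) (ψ : P →ₐ[Kq] U) (π : T →ₐ[Kq] Z)
    (hφ : ∀ i, φ (m i) = x (.F i)) (hχ : ∀ y, χ (t y) = x y.toGen)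
    (hψ : ∀ i, ψ (p i) = x (.E i)) (hm : Algebra.adjoin Kq (Set.range m) = ⊤)
    (ht : Algebra.adjoin Kq (Set.range t) = ⊤) (hp : Algebra.adjoin Kq (Set.range p) = ⊤)
    (hs : ∀ i j, i ≠ j → serreElt a d m i j = 0)
    (ρ : U →ₐ[Kq] Module.End Kq ((List (Fin n) →₀ T ⊗[Kq] P) ⧸ serreSubmodule (T ⊗[Kq] P) a d))
    (hρ : ∀ y v, ρ (x y) (Submodule.Quotient.mk v) = Submodule.Quotient.mk
      (wordOp a d (borelE τ p) (fun i => torusAct T P (t (.K i)))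
        (fun i => torusAct T P (t (.Kinv i))) (torusAct T P (t .g)) (torusAct T P (t .ginv))
        y v)) :
    ∃ Ψ : U →ₗ[Kq] M ⊗[Kq] (Z ⊗[Kq] P), ∀ X Y W,
      Ψ (φ X * χ Y * ψ W) = X ⊗ₜ (π Y ⊗ₜ W) := by
  let base : T ⊗[Kq] P →ₗ[Kq] (List (Fin n) →₀ T ⊗[Kq] P) ⧸ serreSubmodule (T ⊗[Kq] P) a d :=
    (serreSubmodule (T ⊗[Kq] P) a d).mkQ ∘ₗ Finsupp.lsingle []
  let Φ := (serreSubmodule (T ⊗[Kq] P) a d).liftQ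
    (wordEval m (TensorProduct.map π.toLinearMap (LinearMap.id : P →ₗ[Kq] P)))
    (serreSubmodule_le_ker_wordEval hs _)
  have hP : ∀ W z : P, base (1 ⊗ₜ (W * z)) = ρ (ψ W) (base (1 ⊗ₜ z)) := by
    refine intertwining_of_adjoin (α := Algebra.lmul Kq P) (β := ρ.comp ψ)
      (L := base ∘ₗ TensorProduct.mk Kq T P 1) hp ?_
    rintro _ ⟨i, rfl⟩ z
    rw [AlgHom.comp_apply, hψ]
    refine Eq.trans ?_ (hρ _ _).symm
    rw [Finsupp.lsingle_apply, TensorProduct.mk_apply, wordOp, wordE_single_nil, borelE_tmul,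
      map_one (τ i)]
    rfl
  have hT : ∀ Y b, base (torusAct T P Y b) = ρ (χ Y) (base b) := by
    refine intertwining_of_adjoin (β := ρ.comp χ) ht ?_
    rintro _ ⟨y, rfl⟩ b
    rw [AlgHom.comp_apply, hχ]
    refine Eq.trans ?_ (hρ _ _).symm
    rw [Finsupp.lsingle_apply]
    cases y <;> simp only [TorusGen.toGen, wordOp, wordK, wordL, wordDiag_single, List.map_nil,
      List.prod_nil, one_smul] <;> rfl
  have hM : ∀ X v, Φ (ρ (φ X) v) = torusAct M (Z ⊗[Kq] P) X (Φ v) := by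
    refine intertwining_of_adjoin (α := ρ.comp φ) hm ?_
    rintro _ ⟨i, rfl⟩ v
    obtain ⟨v, rfl⟩ := Submodule.Quotient.mk_surjective _ v
    rw [AlgHom.comp_apply, hφ, hρ]
    exact wordEval_wordF _ _ _ _
  have hΦ : ∀ b, Φ (base b) = 1 ⊗ₜ TensorProduct.map π.toLinearMap LinearMap.id b :=
    fun b => wordEval_single _ _ [] b
  refine ⟨Φ ∘ₗ LinearMap.applyₗ (base (1 ⊗ₜ 1)) ∘ₗ ρ.toLinearMap, fun X Y W => ?_⟩
  simp only [LinearMap.comp_apply, AlgHom.toLinearMap_apply, LinearMap.applyₗ_apply_apply, map_mul,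
    Module.End.mul_apply]
  rw [← hP, ← hT, hM, hΦ, torusAct_tmul, torusAct_tmul, mul_one, mul_one, mul_one]
  rfl

end Evaluation

/-! ### Spanning by the triangular products -/

/-- The elements `x` of an algebra satisfy the relations of `U_q`. -/
structure QuantumRel {U : Type*} [Ring U] [Algebra Kq U] (a : Fin n → Fin n → ℤ)
    (d r : Fin n → ℕ) (x : Gen n → U) : Prop where
  efk : EFKRel a d (fun i => x (.E i)) (fun i => x (.F i)) (fun i => x (.K i))
    fun i => x (.Kinv i)
  torus : IsTorusFamily r fun y => x y.toGen
  g_comm : ∀ y, x .g * x y = x y * x .g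
  serreE : ∀ i j, i ≠ j → serreElt a d (fun i => x (.E i)) i j = 0
  serreF : ∀ i j, i ≠ j → serreElt a d (fun i => x (.F i)) i j = 0

section Spanning

variable {k U : Type*} [Field k] [Ring U] [Algebra k U]

theorem mul_adjoin_le_adjoin_mul {S : Submodule k U} {s : Set U}
    (h : ∀ u ∈ S, ∀ v ∈ s, u * v ∈ Subalgebra.toSubmodule (Algebra.adjoin k s) * S) :
    S * Subalgebra.toSubmodule (Algebra.adjoin k s) ≤
      Subalgebra.toSubmodule (Algebra.adjoin k s) * S := by
  refine Submodule.mul_le.mpr fun u hu v hv => ?_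
  rw [Subalgebra.mem_toSubmodule] at hv
  induction hv using Algebra.adjoin_induction generalizing u with
  | mem v hv => exact h u hu v hv
  | algebraMap c =>
    rw [← Algebra.commutes]
    exact Submodule.mul_mem_mul (Subalgebra.algebraMap_mem _ c) hu
  | add v w _ _ hv hw =>
    rw [mul_add]
    exact add_mem (hv u hu) (hw u hu)
  | mul v w _ _ hv hw =>
    rw [← mul_assoc]
    refine Submodule.mul_induction_on (C := fun z => z * w ∈ _) (hv u hu) (fun z hz y hy => ?_)
      fun z y hz hy => ?_
    · rw [mul_assoc, ← (Algebra.adjoin k s).isIdempotentElem_toSubmodule.eq, mul_assoc]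
      exact Submodule.mul_mem_mul hz (hw y hy)
    · rw [add_mul]
      exact add_mem hz hy

theorem adjoin_mul_le_mul_adjoin {S : Submodule k U} {s : Set U}
    (h : ∀ u ∈ S, ∀ v ∈ s, v * u ∈ S * Subalgebra.toSubmodule (Algebra.adjoin k s)) :
    Subalgebra.toSubmodule (Algebra.adjoin k s) * S ≤
      S * Subalgebra.toSubmodule (Algebra.adjoin k s) := by
  refine Submodule.mul_le.mpr fun v hv u hu => ?_
  rw [Subalgebra.mem_toSubmodule] at hv
  induction hv using Algebra.adjoin_induction generalizing u with
  | mem v hv => exact h u hu v hv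
  | algebraMap c =>
    rw [Algebra.commutes]
    exact Submodule.mul_mem_mul hu (Subalgebra.algebraMap_mem _ c)
  | add v w _ _ hv hw =>
    rw [add_mul]
    exact add_mem (hv u hu) (hw u hu)
  | mul v w _ _ hv hw =>
    rw [mul_assoc]
    refine Submodule.mul_induction_on (C := fun z => v * z ∈ _) (hw u hu) (fun z hz y hy => ?_)
      fun z y hz hy => ?_
    · rw [← mul_assoc, ← (Algebra.adjoin k s).isIdempotentElem_toSubmodule.eq, ← mul_assoc]
      exact Submodule.mul_mem_mul (hv z hz) hy
    · rw [mul_add]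
      exact add_mem hz hy

end Spanning

theorem QuantumRel.exists_skewComm {U : Type*} [Ring U] [Algebra Kq U] {a : Fin n → Fin n → ℤ}
    {d r : Fin n → ℕ} {x : Gen n → U} (H : QuantumRel a d r x) (y : TorusGen n) (i : Fin n) :
    (∃ c : Kq, c ≠ 0 ∧ SkewComm c (x y.toGen) (x (.E i))) ∧
      ∃ c : Kq, SkewComm c (x y.toGen) (x (.F i)) := by
  have hg : ∀ y, SkewComm (1 : Kq) (x .g) (x y) := fun y => by simpa [SkewComm] using H.g_comm y
  have hginv : ∀ y, SkewComm (1⁻¹ : Kq) (x .ginv) (x y) := fun y =>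
    (hg y).of_inverse_left one_ne_zero H.torus.g_mul_ginv
      ((H.torus.comm .ginv .g).trans H.torus.g_mul_ginv)
  cases y with
  | K j => exact ⟨⟨_, zpow_ne_zero _ (qi_ne_zero d j), H.efk.KE j i⟩, _, H.efk.KF j i⟩
  | Kinv j => exact ⟨⟨_, zpow_ne_zero _ (qi_ne_zero d j), H.efk.LE j i⟩, _, H.efk.LF j i⟩
  | g => exact ⟨⟨1, one_ne_zero, hg _⟩, 1, hg _⟩
  | ginv => exact ⟨⟨_, inv_ne_zero one_ne_zero, hginv _⟩, _, hginv _⟩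

/-- The triangular products span. -/
theorem QuantumRel.mul_eq_top {U : Type*} [Ring U] [Algebra Kq U] {a : Fin n → Fin n → ℤ}
    {d r : Fin n → ℕ} {x : Gen n → U} (H : QuantumRel a d r x)
    (hx : Algebra.adjoin Kq (Set.range x) = ⊤) :
    Subalgebra.toSubmodule (Algebra.adjoin Kq (Set.range fun i => x (.F i))) *
      (Subalgebra.toSubmodule (Algebra.adjoin Kq (Set.range fun y : TorusGen n => x y.toGen)) *
        Subalgebra.toSubmodule (Algebra.adjoin Kq (Set.range fun i => x (.E i)))) = ⊤ := by
  set M := Subalgebra.toSubmodule (Algebra.adjoin Kq (Set.range fun i => x (.F i)))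
  set Z := Subalgebra.toSubmodule
    (Algebra.adjoin Kq (Set.range fun y : TorusGen n => x y.toGen))
  set P := Subalgebra.toSubmodule (Algebra.adjoin Kq (Set.range fun i => x (.E i)))
  let E : Submodule Kq U := Submodule.span Kq (Set.range fun i => x (.E i))
  have hMM : M * M = M := Subalgebra.isIdempotentElem_toSubmodule _
  have hZZ : Z * Z = Z := Subalgebra.isIdempotentElem_toSubmodule _
  have hPP : P * P = P := Subalgebra.isIdempotentElem_toSubmodule _
  have h1M : (1 : U) ∈ M := one_mem (Algebra.adjoin Kq _)
  have h1Z : (1 : U) ∈ Z := one_mem (Algebra.adjoin Kq _)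
  have h1P : (1 : U) ∈ P := one_mem (Algebra.adjoin Kq _)
  have hxM : ∀ i, x (.F i) ∈ M := fun i => Algebra.subset_adjoin ⟨i, rfl⟩
  have hxZ : ∀ y : TorusGen n, x y.toGen ∈ Z := fun y => Algebra.subset_adjoin ⟨y, rfl⟩
  have hEP : E ≤ P := Submodule.span_le.mpr Algebra.subset_adjoin
  have hZF : ∀ i, Z * Submodule.span Kq {x (.F i)} ≤ Submodule.span Kq {x (.F i)} * Z := by
    intro i
    refine adjoin_mul_le_mul_adjoin ?_
    rintro u hu _ ⟨y, rfl⟩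
    obtain ⟨c, rfl⟩ := Submodule.mem_span_singleton.mp hu
    obtain ⟨c', hc'⟩ := (H.exists_skewComm y i).2
    rw [mul_smul_comm, hc']
    exact Submodule.smul_mem _ _ (Submodule.smul_mem _ _
      (Submodule.mul_mem_mul (Submodule.mem_span_singleton_self _) (hxZ y)))
  have hEZ : E * Z ≤ Z * E := by
    refine mul_adjoin_le_adjoin_mul fun u hu => ?_
    induction hu using Submodule.span_induction with
    | mem u hu =>
      obtain ⟨i, rfl⟩ := hu
      rintro _ ⟨y, rfl⟩
      obtain ⟨c, hc, h⟩ := (H.exists_skewComm y i).1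
      have h' : x (.E i) * x y.toGen = c⁻¹ • (x y.toGen * x (.E i)) := by
        rw [h, smul_smul, inv_mul_cancel₀ hc, one_smul]
      rw [h']
      exact Submodule.smul_mem _ _
        (Submodule.mul_mem_mul (hxZ y) (Submodule.subset_span ⟨i, rfl⟩))
    | zero => intro v _; rw [zero_mul]; exact zero_mem _
    | add u u' _ _ hu hu' =>
      intro v hv
      rw [add_mul]
      exact add_mem (hu v hv) (hu' v hv)
    | smul c u _ hu =>
      intro v hv
      rw [smul_mul_assoc]
      exact Submodule.smul_mem _ _ (hu v hv)
  have hSM : (E ⊔ Z) * M ≤ M * (E ⊔ Z) := by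
    refine mul_adjoin_le_adjoin_mul ?_
    rintro u hu _ ⟨j, rfl⟩
    refine (sup_le (Submodule.span_le.mpr ?_) fun z hz => ?_ :
      E ⊔ Z ≤ (M * (E ⊔ Z)).comap (LinearMap.mulRight Kq (x (.F j)))) hu
    · rintro _ ⟨i, rfl⟩
      have hEF := sub_eq_iff_eq_add.mp (H.efk.EF i j)
      rw [SetLike.mem_coe, Submodule.mem_comap, LinearMap.mulRight_apply, hEF]
      refine add_mem ?_ (Submodule.mul_mem_mul (hxM j)
        (Submodule.mem_sup_left (Submodule.subset_span ⟨i, rfl⟩)))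
      split_ifs
      · rw [← one_mul (_ • _)]
        exact Submodule.mul_mem_mul h1M (Submodule.mem_sup_right (Submodule.smul_mem _ _
          (sub_mem (hxZ (.K i)) (hxZ (.Kinv i)))))
      · exact zero_mem _
    · exact mul_le_mul' ((Submodule.span_singleton_le_iff_mem _ _).mpr (hxM j)) le_sup_right
        (hZF j (Submodule.mul_mem_mul hz (Submodule.mem_span_singleton_self _)))
  have hS : (E ⊔ Z) * (M * (Z * P)) ≤ M * (Z * P) := calc
    (E ⊔ Z) * (M * (Z * P)) = (E ⊔ Z) * M * (Z * P) := (mul_assoc _ _ _).symm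
    _ ≤ M * (E ⊔ Z) * (Z * P) := mul_le_mul' hSM le_rfl
    _ = M * ((E ⊔ Z) * Z * P) := by simp only [mul_assoc]
    _ = M * ((E * Z * P) ⊔ (Z * P)) := by rw [Submodule.sup_mul, Submodule.sup_mul, hZZ]
    _ ≤ M * (Z * P) := by
      refine mul_le_mul' le_rfl (sup_le ?_ le_rfl)
      calc E * Z * P ≤ Z * E * P := mul_le_mul' hEZ le_rfl
        _ = Z * (E * P) := mul_assoc _ _ _
        _ ≤ Z * (P * P) := mul_le_mul' le_rfl (mul_le_mul' hEP le_rfl)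
        _ = Z * P := by rw [hPP]
  have hstab : ∀ u v, v ∈ M * (Z * P) → u * v ∈ M * (Z * P) := by
    intro u
    have hu : u ∈ Algebra.adjoin Kq (Set.range x) := hx ▸ Algebra.mem_top
    induction hu using Algebra.adjoin_induction with
    | mem u hu =>
      intro v hv
      obtain ⟨y, rfl⟩ := hu
      have hz : ∀ y : TorusGen n, x y.toGen * v ∈ M * (Z * P) := fun y =>
        hS (Submodule.mul_mem_mul (Submodule.mem_sup_right (hxZ y)) hv)
      cases y with
      | E i =>
        exact hS (Submodule.mul_mem_mul
          (Submodule.mem_sup_left (Submodule.subset_span ⟨i, rfl⟩)) hv)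
      | F i =>
        rw [← hMM, mul_assoc]
        exact Submodule.mul_mem_mul (hxM i) hv
      | K i => exact hz (.K i)
      | Kinv i => exact hz (.Kinv i)
      | g => exact hz .g
      | ginv => exact hz .ginv
    | algebraMap c =>
      intro v hv
      rw [← Algebra.smul_def]
      exact Submodule.smul_mem _ _ hv
    | add u u' _ _ hu hu' =>
      intro v hv
      rw [add_mul]
      exact add_mem (hu v hv) (hu' v hv)
    | mul u u' _ _ hu hu' =>
      intro v hv
      rw [mul_assoc]
      exact hu _ (hu' v hv)
  refine Submodule.eq_top_iff'.mpr fun u => ?_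
  have h1 : (1 : U) * (1 * 1) ∈ M * (Z * P) :=
    Submodule.mul_mem_mul h1M (Submodule.mul_mem_mul h1Z h1P)
  simpa using hstab u _ h1

/-! ### The triangular decomposition -/

theorem quantumRel_gen (a : Fin n → Fin n → ℤ) (d r : Fin n → ℕ) :
    QuantumRel a d r (gen a d r) where
  efk :=
    { KL i := by
        simpa [gen] using RingQuot.mkAlgHom_rel Kq (QRel.KKinv (a := a) (d := d) (r := r) i)
      LK i := by
        simpa [gen] using RingQuot.mkAlgHom_rel Kq (QRel.KinvK (a := a) (d := d) (r := r) i)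
      KE i j := by
        simpa [gen, SkewComm] using
          RingQuot.mkAlgHom_rel Kq (QRel.KE (a := a) (d := d) (r := r) i j)
      KF i j := by
        simpa [gen, SkewComm] using
          RingQuot.mkAlgHom_rel Kq (QRel.KF (a := a) (d := d) (r := r) i j)
      EF i j := by
        have := RingQuot.mkAlgHom_rel Kq (QRel.EF (a := a) (d := d) (r := r) i j)
        rw [apply_ite (RingQuot.mkAlgHom Kq (QRel a d r))] at this
        simpa [gen] using this }
  torus := by
    have inv {u v w : Uq a d r} (h₁ : u * v = 1) (h₂ : v * u = 1) (h : Commute u w) :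
        Commute v w := Commute.units_inv_left (u := ⟨u, v, h₁, h₂⟩) h
    have rel {u u' : FA n} (h : QRel a d r u u') := RingQuot.mkAlgHom_rel Kq h
    have hKL : ∀ i, gen a d r (.K i) * gen a d r (.Kinv i) = 1 := fun i => by
      simpa [gen] using rel (.KKinv i)
    have hLK : ∀ i, gen a d r (.Kinv i) * gen a d r (.K i) = 1 := fun i => by
      simpa [gen] using rel (.KinvK i)
    have hgh : gen a d r .g * gen a d r .ginv = 1 := by simpa [gen] using rel .gginv
    have hhg : gen a d r .ginv * gen a d r .g = 1 := by simpa [gen] using rel .ginvg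
    have cg : ∀ y, Commute (gen a d r .g) (gen a d r y) := fun y => by
      simpa [gen, Commute, SemiconjBy] using rel (.gcomm y)
    have cK : ∀ i j, Commute (gen a d r (.K i)) (gen a d r (.K j)) :=
      fun i j => by simpa [gen, Commute, SemiconjBy] using rel (.KK i j)
    have ch : ∀ y, Commute (gen a d r .ginv) (gen a d r y) := fun y => inv hgh hhg (cg y)
    have cK' : ∀ i (y : TorusGen n), Commute (gen a d r (.K i)) (gen a d r y.toGen) := by
      intro i y
      cases y with
      | K j => exact cK i j
      | Kinv j => exact (inv (hKL j) (hLK j) (cK j i)).symm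
      | g => exact (cg _).symm
      | ginv => exact (ch _).symm
    exact
      { comm y z := by
          cases y with
          | K i => exact cK' i z
          | Kinv i => exact inv (hKL i) (hLK i) (cK' i z)
          | g => exact cg _
          | ginv => exact ch _
        K_mul_Kinv := hKL
        g_mul_ginv := hgh
        g_mul_g := by
          simpa [gen, TorusGen.toGen, map_list_prod, Function.comp_def] using rel .gsq }
  g_comm y := by
    simpa [gen] using RingQuot.mkAlgHom_rel Kq (QRel.gcomm (a := a) (d := d) (r := r) y)
  serreE i j hij := by
    have := RingQuot.mkAlgHom_rel Kq (QRel.serreEE (a := a) (d := d) (r := r) i j hij)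
    rw [map_zero] at this
    rw [← this]
    exact (map_serreElt _ a d (fun i => ι (Gen.E i)) i j).symm
  serreF i j hij := by
    have := RingQuot.mkAlgHom_rel Kq (QRel.serreFF (a := a) (d := d) (r := r) i j hij)
    rw [map_zero] at this
    rw [← this]
    exact (map_serreElt _ a d (fun i => ι (Gen.F i)) i j).symm

theorem adjoin_range_gen (a : Fin n → Fin n → ℤ) (d r : Fin n → ℕ) :
    Algebra.adjoin Kq (Set.range (gen a d r)) = ⊤ := by
  have h : Set.range (gen a d r) = RingQuot.mkAlgHom Kq (QRel a d r) '' Set.range ι := by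
    rw [← Set.range_comp]
    rfl
  rw [h, ← AlgHom.map_adjoin, ι, FreeAlgebra.adjoin_range_ι, Algebra.map_top,
    AlgHom.range_eq_top]
  exact RingQuot.mkAlgHom_surjective _ _

theorem Torus.adjoin_range_of (r : Fin n → ℕ) :
    Algebra.adjoin Kq (Set.range (Torus.of r)) = ⊤ := by
  have h : Set.range (of r) =
      RingQuot.mkAlgHom Kq (TorusRel r) '' Set.range (FreeAlgebra.ι Kq) := by
    rw [← Set.range_comp]
    rfl
  rw [h, ← AlgHom.map_adjoin, FreeAlgebra.adjoin_range_ι, Algebra.map_top, AlgHom.range_eq_top]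
  exact RingQuot.mkAlgHom_surjective _ _

theorem adjoin_range_eq_top {I U : Type*} [Ring U] [Algebra Kq U] {y : I → U}
    {S : Subalgebra Kq U} {y' : I → S} (hS : S = Algebra.adjoin Kq (Set.range y))
    (hy : ∀ i, (y' i : U) = y i) : Algebra.adjoin Kq (Set.range y') = ⊤ := by
  refine Subalgebra.map_injective (f := S.val) Subtype.val_injective ?_
  rw [AlgHom.map_adjoin, ← Set.range_comp, Algebra.map_top, Subalgebra.range_val]
  exact (congrArg (fun z => Algebra.adjoin Kq (Set.range z)) (funext hy)).trans hS.symm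

section Decomposition

variable {U : Type} [Ring U] [Algebra Kq U] {a : Fin n → Fin n → ℤ} {d r : Fin n → ℕ}
  {x : Gen n → U} {Um U0 Up : Subalgebra Kq U}

theorem QuantumRel.exists_torus_lift (H : QuantumRel a d r x)
    (hU0 : U0 = Algebra.adjoin Kq (Set.range fun y : TorusGen n => x y.toGen)) :
    ∃ π : Torus r →ₐ[Kq] U0, (∀ y, (π (Torus.of r y) : U) = x y.toGen) ∧
      Function.Surjective π := by
  let z : TorusGen n → U0 := fun y => ⟨x y.toGen, hU0 ▸ Algebra.subset_adjoin ⟨y, rfl⟩⟩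
  have hz : IsTorusFamily r z :=
    { comm y y' := Subtype.ext (H.torus.comm y y')
      K_mul_Kinv i := Subtype.ext (H.torus.K_mul_Kinv i)
      g_mul_ginv := Subtype.ext H.torus.g_mul_ginv
      g_mul_g := Subtype.ext <| by
        have := H.torus.g_mul_g
        simpa [z, Function.comp_def] using this }
  obtain ⟨π, hπ⟩ := Torus.exists_lift hz
  have hπ' : ∀ y, (π (Torus.of r y) : U) = x y.toGen := fun y => congrArg Subtype.val (hπ y)
  refine ⟨π, hπ', ?_⟩
  rw [← AlgHom.range_eq_top, ← Algebra.map_top, ← Torus.adjoin_range_of, AlgHom.map_adjoin,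
    ← Set.range_comp]
  exact adjoin_range_eq_top hU0 hπ'

theorem exists_left_inverse_of_rep {M T Z P : Type} [Ring M] [Algebra Kq M] [Ring T]
    [Algebra Kq T] [Ring Z] [Algebra Kq Z] [Ring P] [Algebra Kq P] {m : Fin n → M} {p : Fin n → P}
    {t : TorusGen n → T} {τ : Fin n → T →ₐ[Kq] T}
    (hrep : ∀ (B : Type) [AddCommGroup B] [Module Kq B] (e k l : Fin n → Module.End Kq B)
      (g h : Module.End Kq B), BorelRel a d r e k l g h →
      (∀ i j, i ≠ j → serreElt a d e i j = 0) →
      ∃ ρ : U →ₐ[Kq] Module.End Kq ((List (Fin n) →₀ B) ⧸ serreSubmodule B a d),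
        ∀ y v, ρ (x y) (Submodule.Quotient.mk v) =
          Submodule.Quotient.mk (wordOp a d e k l g h y v))
    (φ : M →ₐ[Kq] U) (χ : T →ₐ[Kq] U) (ψ : P →ₐ[Kq] U) (π : T →ₐ[Kq] Z)
    (hφ : ∀ i, φ (m i) = x (.F i)) (hχ : ∀ y, χ (t y) = x y.toGen)
    (hψ : ∀ i, ψ (p i) = x (.E i)) (hm : Algebra.adjoin Kq (Set.range m) = ⊤)
    (ht : Algebra.adjoin Kq (Set.range t) = ⊤) (hp : Algebra.adjoin Kq (Set.range p) = ⊤)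
    (hms : ∀ i j, i ≠ j → serreElt a d m i j = 0) (hps : ∀ i j, i ≠ j → serreElt a d p i j = 0)
    (htt : IsTorusFamily r t) (hτ : ∀ j y, τ j (t y) = torusScalar a d j y • t y)
    (hττ : ∀ i j, (τ i).comp (τ j) = (τ j).comp (τ i)) :
    ∃ Ψ : U →ₗ[Kq] M ⊗[Kq] (Z ⊗[Kq] P), ∀ X Y W,
      Ψ (φ X * χ Y * ψ W) = X ⊗ₜ (π Y ⊗ₜ W) := by
  obtain ⟨ρ, hρ⟩ := hrep (T ⊗[Kq] P) _ _ _ _ _ (borelRel (p := p) htt hτ)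
    fun i j hij => borelE_serre (hττ i j) (hps i j hij)
  exact exists_left_inverse φ χ ψ π hφ hχ hψ hm ht hp hms ρ hρ

/-- Triangular multiplication has a left inverse as soon as the algebra acts on words modulo Serre
relations. -/
theorem QuantumRel.exists_linearMap (H : QuantumRel a d r x) (hC : CartanData n a d r)
    (hrep : ∀ (B : Type) [AddCommGroup B] [Module Kq B] (e k l : Fin n → Module.End Kq B)
      (g h : Module.End Kq B), BorelRel a d r e k l g h →
      (∀ i j, i ≠ j → serreElt a d e i j = 0) →
      ∃ ρ : U →ₐ[Kq] Module.End Kq ((List (Fin n) →₀ B) ⧸ serreSubmodule B a d),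
        ∀ y v, ρ (x y) (Submodule.Quotient.mk v) =
          Submodule.Quotient.mk (wordOp a d e k l g h y v))
    (hUm : Um = Algebra.adjoin Kq (Set.range fun i => x (.F i)))
    (hU0 : U0 = Algebra.adjoin Kq (Set.range fun y : TorusGen n => x y.toGen))
    (hUp : Up = Algebra.adjoin Kq (Set.range fun i => x (.E i))) :
    ∃ Ψ : U →ₗ[Kq] Um ⊗[Kq] (U0 ⊗[Kq] Up), ∀ (X : Um) (Y : U0) (Z : Up),
      Ψ ((X : U) * (Y : U) * (Z : U)) = X ⊗ₜ[Kq] (Y ⊗ₜ[Kq] Z) := by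
  let m : Fin n → Um := fun i => ⟨x (.F i), hUm ▸ Algebra.subset_adjoin ⟨i, rfl⟩⟩
  let p : Fin n → Up := fun i => ⟨x (.E i), hUp ▸ Algebra.subset_adjoin ⟨i, rfl⟩⟩
  obtain ⟨π, hπ, hπs⟩ := H.exists_torus_lift hU0
  have hms : ∀ i j, i ≠ j → serreElt a d m i j = 0 := fun i j hij => Subtype.ext <|
    (map_serreElt Um.val a d m i j).trans (H.serreF i j hij)
  have hps : ∀ i j, i ≠ j → serreElt a d p i j = 0 := fun i j hij => Subtype.ext <|
    (map_serreElt Up.val a d p i j).trans (H.serreE i j hij)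
  obtain ⟨τ, hτ, hττ⟩ := Torus.exists_twist hC
  obtain ⟨Ψ, hΨ⟩ := exists_left_inverse_of_rep (m := m) (p := p) hrep Um.val (U0.val.comp π) Up.val
    π (fun _ => rfl) hπ (fun _ => rfl) (adjoin_range_eq_top hUm fun _ => rfl)
    (Torus.adjoin_range_of r) (adjoin_range_eq_top hUp fun _ => rfl) hms hps
    Torus.isTorusFamily_of hτ hττ
  refine ⟨Ψ, fun X Y Z => ?_⟩
  obtain ⟨s, rfl⟩ := hπs Y
  exact hΨ X s Z

/-- The triangular decomposition, given a left inverse of triangular multiplication. -/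
theorem QuantumRel.exists_bijective (H : QuantumRel a d r x)
    (hx : Algebra.adjoin Kq (Set.range x) = ⊤)
    (hUm : Um = Algebra.adjoin Kq (Set.range fun i => x (.F i)))
    (hU0 : U0 = Algebra.adjoin Kq (Set.range fun y : TorusGen n => x y.toGen))
    (hUp : Up = Algebra.adjoin Kq (Set.range fun i => x (.E i)))
    {Ψ : U →ₗ[Kq] Um ⊗[Kq] (U0 ⊗[Kq] Up)}
    (hΨ : ∀ (X : Um) (Y : U0) (Z : Up),
      Ψ ((X : U) * (Y : U) * (Z : U)) = X ⊗ₜ[Kq] (Y ⊗ₜ[Kq] Z)) :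
    ∃ f : (Um ⊗[Kq] (U0 ⊗[Kq] Up)) →ₗ[Kq] U,
      (∀ (X : Um) (Y : U0) (Z : Up), f (X ⊗ₜ[Kq] (Y ⊗ₜ[Kq] Z)) = (X : U) * (Y : U) * (Z : U)) ∧
      Function.Bijective f := by
  let f : (Um ⊗[Kq] (U0 ⊗[Kq] Up)) →ₗ[Kq] U :=
    LinearMap.mul' Kq U ∘ₗ TensorProduct.map Um.val.toLinearMap
      (LinearMap.mul' Kq U ∘ₗ TensorProduct.map U0.val.toLinearMap Up.val.toLinearMap)
  have hf : ∀ (X : Um) (Y : U0) (Z : Up),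
      f (X ⊗ₜ[Kq] (Y ⊗ₜ[Kq] Z)) = (X : U) * (Y : U) * (Z : U) :=
    fun X Y Z => by simp [f, mul_assoc]
  have hΨf : ∀ t, Ψ (f t) = t := by
    intro t
    induction t with
    | zero => rw [map_zero, map_zero]
    | add t t' ht ht' => rw [map_add, map_add, ht, ht']
    | tmul X w =>
      induction w with
      | zero => rw [TensorProduct.tmul_zero, map_zero, map_zero]
      | add w w' hw hw' => rw [TensorProduct.tmul_add, map_add, map_add, hw, hw']
      | tmul Y Z => rw [hf, hΨ]
  refine ⟨f, hf, Function.LeftInverse.injective hΨf, ?_⟩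
  have htop := H.mul_eq_top hx
  rw [← hUm, ← hU0, ← hUp] at htop
  rw [← LinearMap.range_eq_top, eq_top_iff, ← htop, Submodule.mul_le]
  intro X hX w hw
  refine Submodule.mul_induction_on (C := fun w => X * w ∈ LinearMap.range f) hw
    (fun Y hY Z hZ => ?_) fun w w' hw hw' => ?_
  · exact ⟨⟨X, hX⟩ ⊗ₜ (⟨Y, hY⟩ ⊗ₜ ⟨Z, hZ⟩), (hf _ _ _).trans (mul_assoc _ _ _)⟩
  · rw [mul_add]
    exact add_mem hw hw'

end Decomposition

/-- Triangular decomposition: the multiplication map `U⁻ ⊗ U⁰ ⊗ U⁺ → U_q` is bijective,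
where `U⁺`, `U⁻`, `U⁰` are the subalgebras generated by the `E_i`, by the `F_i`, and by
the `K_i^{±1}, γ^{±1/2}` respectively. -/
theorem triangular_decomposition {n : ℕ} (a : Fin n → Fin n → ℤ) (d r : Fin n → ℕ)
    (hC : CartanData n a d r)
    (Up Um U0 : Subalgebra Kq (Uq a d r))
    (hUp : Up = Algebra.adjoin Kq (Set.range fun i => gen a d r (Gen.E i)))
    (hUm : Um = Algebra.adjoin Kq (Set.range fun i => gen a d r (Gen.F i)))
    (hU0 : U0 = Algebra.adjoin Kq
      ((Set.range fun i => gen a d r (Gen.K i)) ∪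
       (Set.range fun i => gen a d r (Gen.Kinv i)) ∪
       {gen a d r Gen.g, gen a d r Gen.ginv})) :
    ∃ f : (Um ⊗[Kq] (U0 ⊗[Kq] Up)) →ₗ[Kq] Uq a d r,
      (∀ (x : Um) (y : U0) (z : Up),
        f (x ⊗ₜ[Kq] (y ⊗ₜ[Kq] z)) = (x : Uq a d r) * (y : Uq a d r) * (z : Uq a d r)) ∧
      Function.Bijective f := by
  have H := quantumRel_gen a d r
  have hU0' : U0 = Algebra.adjoin Kq (Set.range fun y : TorusGen n => gen a d r y.toGen) := by
    refine hU0.trans (congrArg _ ?_)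
    ext u
    constructor
    · rintro ((⟨i, rfl⟩ | ⟨i, rfl⟩) | rfl | rfl)
      exacts [⟨.K i, rfl⟩, ⟨.Kinv i, rfl⟩, ⟨.g, rfl⟩, ⟨.ginv, rfl⟩]
    · rintro ⟨i | i | _ | _, rfl⟩ <;> simp [TorusGen.toGen]
  obtain ⟨Ψ, hΨ⟩ := H.exists_linearMap hC (fun B _ _ e k l g h H hs => H.exists_rep hC hs)
    hUm hU0' hUp
  exact H.exists_bijective (adjoin_range_gen a d r) hUm hU0' hUp hΨ

end
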